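/- arXiv:math-ph/9812008 — 14 statements merged into one kernel-verified Lean document; each statement's English description precedes it below -/
import Mathlib

section
/- Let ν be a positive integer and let S be an entropy function on the continuum ℝ^ν (satisfying axioms (A)–(D)). Then for any two boxes Λ_a ⊆ Λ_b (where a, b are ν-tuples of positive reals with aᵢ ≤ bᵢ for each i), the mean entropy decreases: S(Λ_a)/vol(Λ_a) ≥ S(Λ_b)/vol(Λ_b). -/
open MeasureTheory

/-- A continuum region: a Lebesgue-measurable subset of `ℝ^ν` of finite
nonzero volume. -/
def IsRegion {ν : ℕ} (Λ : Set (Fin ν → ℝ)) : Prop :=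
  MeasurableSet Λ ∧ volume Λ ≠ 0 ∧ volume Λ ≠ ⊤

/-- The box region `Λ_a = {x ∈ ℝ^ν : 0 < xᵢ ≤ aᵢ}` for a `ν`-tuple `a` of
positive reals. -/
def contBox (ν : ℕ) (a : Fin ν → ℝ) : Set (Fin ν → ℝ) :=
  Set.univ.pi fun i => Set.Ioc 0 (a i)

theorem one_dim_mono (f : ℝ → ℝ) (hA : ∀ t, 0 < t → 0 ≤ f t)
    (hC : ∀ x y z, 0 < x → 0 < y → 0 < z → f (x + y + z) + f y ≤ f (x + y) + f (y + z))
    (y h : ℝ) (hy : 0 < y) (hh : 0 < h) : f y ≤ f (y + h) := by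
  by_contra! hlt
  have key : ∀ n : ℕ, f (y + (n + 1) * h) ≤ f y + (n + 1) * (f (y + h) - f y) := by
    intro n
    induction n with
    | zero => simp
    | succ n ih =>
      have h1 := hC ((n + 1) * h) y h (by positivity) hy hh
      have e1 : ((n : ℝ) + 1) * h + y + h = y + ((n + 1 : ℕ) + 1) * h := by push_cast; ring
      have e2 : ((n : ℝ) + 1) * h + y = y + (n + 1) * h := by ring
      rw [e1, e2] at h1
      push_cast at *
      linarith
  obtain ⟨n, hn⟩ := exists_nat_gt (f y / (f y - f (y + h)))
  rw [div_lt_iff₀ (by linarith)] at hn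
  have h1 := key n
  have h2 := hA (y + (n + 1) * h) (by positivity)
  nlinarith

theorem one_dim_step (f : ℝ → ℝ)
    (hB : ∀ s t, 0 < s → 0 < t → f (s + t) ≤ f s + f t)
    (hC : ∀ x y z, 0 < x → 0 < y → 0 < z → f (x + y + z) + f y ≤ f (x + y) + f (y + z))
    (h : ℝ) (hh : 0 < h) (k : ℕ) :
    ((k : ℝ) + 1) * f ((k + 2) * h) ≤ (k + 2) * f ((k + 1) * h) := by
  induction k with
  | zero =>
    have := hB h h hh hh
    simp only [Nat.cast_zero, zero_add, one_mul]
    rw [two_mul h]; linarith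
  | succ k ih =>
    have h1 := hC h ((k + 1) * h) h hh (by positivity) hh
    have e1 : h + ((k : ℝ) + 1) * h + h = (k + 3) * h := by ring
    have e2 : h + ((k : ℝ) + 1) * h = (k + 2) * h := by ring
    have e3 : ((k : ℝ) + 1) * h + h = (k + 2) * h := by ring
    rw [e1, e2, e3] at h1
    have e4 : ((k + 1 : ℕ) : ℝ) + 2 = k + 3 := by push_cast; ring
    have e5 : ((k + 1 : ℕ) : ℝ) + 1 = k + 2 := by push_cast; ring
    rw [e4, e5]
    have h2 := mul_le_mul_of_nonneg_left h1 (by positivity : (0 : ℝ) ≤ k + 2)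
    nlinarith

theorem one_dim_nat (f : ℝ → ℝ)
    (hB : ∀ s t, 0 < s → 0 < t → f (s + t) ≤ f s + f t)
    (hC : ∀ x y z, 0 < x → 0 < y → 0 < z → f (x + y + z) + f y ≤ f (x + y) + f (y + z))
    (h : ℝ) (hh : 0 < h) (p q : ℕ) (hp : 0 < p) (hpq : p ≤ q) :
    f (q * h) / q ≤ f (p * h) / p := by
  induction q, hpq using Nat.le_induction with
  | base => exact le_rfl
  | succ q hq ih =>
    refine le_trans ?_ ih
    obtain ⟨k, rfl⟩ : ∃ k, q = k + 1 := ⟨q - 1, by omega⟩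
    have h1 := one_dim_step f hB hC h hh k
    have e4 : ((k + 1 + 1 : ℕ) : ℝ) = k + 2 := by push_cast; ring
    have e5 : ((k + 1 : ℕ) : ℝ) = k + 1 := by push_cast; ring
    rw [e4, e5, div_le_div_iff₀ (by positivity) (by positivity)]
    linarith

theorem one_dim (f : ℝ → ℝ) (hA : ∀ t, 0 < t → 0 ≤ f t)
    (hB : ∀ s t, 0 < s → 0 < t → f (s + t) ≤ f s + f t)
    (hC : ∀ x y z, 0 < x → 0 < y → 0 < z → f (x + y + z) + f y ≤ f (x + y) + f (y + z))
    (a b : ℝ) (ha : 0 < a) (hab : a ≤ b) : f b / b ≤ f a / a := by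
  have hb : 0 < b := ha.trans_le hab
  have key : ∀ p : ℕ, 0 < p → p * (f b - f a * (b / a)) ≤ f a := by
    intro p hp
    have hp' : (0 : ℝ) < p := by exact_mod_cast hp
    have hr : 1 ≤ b / a := (one_le_div ha).2 hab
    set q := ⌈p * (b / a)⌉₊ with hq
    have q1 : p * (b / a) ≤ q := Nat.le_ceil _
    have q2 : (q : ℝ) < p * (b / a) + 1 := Nat.ceil_lt_add_one (by positivity)
    have hpq : (p : ℝ) ≤ q := by nlinarith
    have hq0 : (0 : ℝ) < q := by linarith
    have h1 := one_dim_nat f hB hC (a / p) (by positivity) p q hp (by exact_mod_cast hpq)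
    rw [mul_div_cancel₀ a hp'.ne', div_le_div_iff₀ hq0 hp'] at h1
    have hbq : b ≤ q * (a / p) := by
      have : b = (p * (b / a)) * (a / p) := by field_simp
      rw [this]
      exact mul_le_mul_of_nonneg_right q1 (by positivity)
    have h2 : f b ≤ f (q * (a / p)) := by
      rcases hbq.eq_or_lt with h | h
      · rw [← h]
      · have := one_dim_mono f hA hC b (q * (a / p) - b) hb (by linarith)
        simpa using this
    have h3 := mul_le_mul_of_nonneg_right h2 hp'.le
    have h4 := mul_le_mul_of_nonneg_left q2.le (hA a ha)
    nlinarith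
  have hle : f b ≤ f a * (b / a) := by
    by_contra! hlt
    obtain ⟨n, hn⟩ := exists_nat_gt (f a / (f b - f a * (b / a)))
    rw [div_lt_iff₀ (by linarith)] at hn
    have := key (n + 1) (by omega)
    push_cast at this
    nlinarith
  rw [div_le_div_iff₀ hb ha]
  calc f b * a ≤ f a * (b / a) * a := mul_le_mul_of_nonneg_right hle ha.le
    _ = f a * b := by field_simp

theorem contBox_volume {ν : ℕ} (c : Fin ν → ℝ) :
    volume (contBox ν c) = ∏ i, ENNReal.ofReal (c i) := by
  simp [contBox, volume_pi_pi]

theorem contBox_volume_toReal {ν : ℕ} (c : Fin ν → ℝ) (hc : ∀ i, 0 < c i) :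
    (volume (contBox ν c)).toReal = ∏ i, c i := by
  rw [contBox_volume, ENNReal.toReal_prod]
  exact Finset.prod_congr rfl fun i _ => ENNReal.toReal_ofReal (hc i).le

theorem contBox_region {ν : ℕ} (c : Fin ν → ℝ) (hc : ∀ i, 0 < c i) :
    IsRegion (contBox ν c) := by
  refine ⟨MeasurableSet.univ_pi fun i => measurableSet_Ioc, ?_, ?_⟩
  · rw [contBox_volume, Finset.prod_ne_zero_iff]
    intro i _
    simpa using hc i
  · rw [contBox_volume]
    exact ENNReal.prod_ne_top fun i _ => ENNReal.ofReal_ne_top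

theorem shift_region {ν : ℕ} (τ : Fin ν → ℝ) (Λ : Set (Fin ν → ℝ)) (h : IsRegion Λ) :
    IsRegion ((fun x => τ + x) '' Λ) := by
  obtain ⟨h1, h2, h3⟩ := h
  refine ⟨(MeasurableEquiv.addLeft τ).measurableSet_image.2 h1, ?_, ?_⟩
  · simpa [Set.image_add_left, measure_preimage_add] using h2
  · simpa [Set.image_add_left, measure_preimage_add] using h3

theorem mem_box_update {ν : ℕ} (c : Fin ν → ℝ) (i : Fin ν) (t : ℝ) (x : Fin ν → ℝ) :
    x ∈ contBox ν (Function.update c i t) ↔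
      (0 < x i ∧ x i ≤ t) ∧ ∀ j, j ≠ i → 0 < x j ∧ x j ≤ c j := by
  simp only [contBox, Set.mem_pi, Set.mem_univ, true_imp_iff, Set.mem_Ioc]
  constructor
  · intro h
    refine ⟨by simpa using h i, fun j hj => by simpa [hj] using h j⟩
  · rintro ⟨h1, h2⟩ j
    by_cases hj : j = i
    · subst hj; simpa using h1
    · simpa [hj] using h2 j hj

theorem mem_shift_box_update {ν : ℕ} (c : Fin ν → ℝ) (i : Fin ν) (s t : ℝ) (x : Fin ν → ℝ) :
    x ∈ (fun x => Pi.single i s + x) '' contBox ν (Function.update c i t) ↔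
      (s < x i ∧ x i ≤ s + t) ∧ ∀ j, j ≠ i → 0 < x j ∧ x j ≤ c j := by
  rw [Set.image_add_left, Set.mem_preimage, mem_box_update]
  refine and_congr ?_ (forall_congr' fun j => imp_congr_right fun hj => ?_)
  · simp only [Pi.add_apply, Pi.neg_apply, Pi.single_eq_same]
    constructor <;> rintro ⟨h1, h2⟩ <;> constructor <;> linarith
  · simp [hj]

/-- **Theorem 1 (continuum case)**: for an entropy function on `ℝ^ν`
satisfying positivity, subadditivity, strong subadditivity and translation
invariance (and unchanged under modification by null sets), the mean entropy
of boxes decreases as boxes increase in the sense of set inclusion. -/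
theorem meanEntropy_antitone_continuum (ν : ℕ) (hν : 0 < ν)
    (S : Set (Fin ν → ℝ) → ℝ)
    (hNull : ∀ Λ Λ' : Set (Fin ν → ℝ), IsRegion Λ → IsRegion Λ' →
      volume (symmDiff Λ Λ') = 0 → S Λ = S Λ')
    (hA : ∀ Λ : Set (Fin ν → ℝ), IsRegion Λ → 0 ≤ S Λ)
    (hB : ∀ Λ₁ Λ₂ : Set (Fin ν → ℝ), IsRegion Λ₁ → IsRegion Λ₂ →
      volume (Λ₁ ∩ Λ₂) = 0 → S (Λ₁ ∪ Λ₂) ≤ S Λ₁ + S Λ₂)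
    (hC : ∀ Λ₁ Λ₂ : Set (Fin ν → ℝ), IsRegion Λ₁ → IsRegion Λ₂ →
      volume (Λ₁ ∩ Λ₂) ≠ 0 → S (Λ₁ ∪ Λ₂) + S (Λ₁ ∩ Λ₂) ≤ S Λ₁ + S Λ₂)
    (hD : ∀ (τ : Fin ν → ℝ) (Λ : Set (Fin ν → ℝ)), IsRegion Λ →
      S ((fun x => τ + x) '' Λ) = S Λ)
    (a b : Fin ν → ℝ) (ha : ∀ i, 0 < a i) (hb : ∀ i, 0 < b i)
    (hab : ∀ i, a i ≤ b i) :
    S (contBox ν b) / (volume (contBox ν b)).toReal ≤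
      S (contBox ν a) / (volume (contBox ν a)).toReal := by
  classical
  have step : ∀ (c : Fin ν → ℝ) (i : Fin ν) (t : ℝ), (∀ j, 0 < c j) → c i ≤ t →
      S (contBox ν (Function.update c i t)) / ∏ j, Function.update c i t j ≤
        S (contBox ν c) / ∏ j, c j := by
    intro c i t hc hct
    have hpos : ∀ t, 0 < t → ∀ j, 0 < Function.update c i t j := by
      intro t ht j
      by_cases hj : j = i
      · subst hj; simpa using ht
      · simpa [hj] using hc j
    have hreg : ∀ t, 0 < t → IsRegion (contBox ν (Function.update c i t)) :=
      fun t ht => contBox_region _ (hpos t ht)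
    have h1 := one_dim (fun t => S (contBox ν (Function.update c i t)))
      (fun t ht => hA _ (hreg t ht)) ?_ ?_ (c i) t (hc i) hct
    · simp only [Function.update_eq_self] at h1
      have hP : 0 < ∏ j ∈ Finset.univ \ {i}, c j := Finset.prod_pos fun j _ => hc j
      rw [Finset.prod_update_of_mem (Finset.mem_univ i),
        ← Finset.mul_prod_erase Finset.univ c (Finset.mem_univ i),
        ← Finset.sdiff_singleton_eq_erase, ← div_div, ← div_div]
      exact div_le_div_of_nonneg_right h1 hP.le
    · intro s t hs ht
      have h := hB _ _ (hreg s hs) (shift_region (Pi.single i s) _ (hreg t ht)) ?_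
      · rw [hD _ _ (hreg t ht)] at h
        convert h using 2
        ext x
        rw [Set.mem_union, mem_box_update, mem_box_update, mem_shift_box_update, ← or_and_right]
        refine and_congr_left fun _ => ?_
        constructor
        · rintro ⟨h1, h2⟩
          rcases le_or_gt (x i) s with h | h
          · exact Or.inl ⟨h1, h⟩
          · exact Or.inr ⟨h, h2⟩
        · rintro (⟨h1, h2⟩ | ⟨h1, h2⟩) <;> constructor <;> linarith
      · convert measure_empty (μ := volume)
        ext x
        rw [Set.mem_inter_iff, mem_box_update, mem_shift_box_update]
        simp only [Set.mem_empty_iff_false, iff_false]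
        rintro ⟨⟨⟨_, h1⟩, _⟩, ⟨⟨h2, _⟩, _⟩⟩
        linarith
    · intro x y z hx hy hz
      have hI : contBox ν (Function.update c i (x + y)) ∩
          (fun v => Pi.single i x + v) '' contBox ν (Function.update c i (y + z)) =
          (fun v => Pi.single i x + v) '' contBox ν (Function.update c i y) := by
        ext v
        rw [Set.mem_inter_iff, mem_box_update, mem_shift_box_update, mem_shift_box_update,
          ← and_and_right]
        refine and_congr_left fun _ => ?_
        constructor
        · rintro ⟨⟨h1, h2⟩, h3, h4⟩
          exact ⟨h3, h2⟩
        · rintro ⟨h1, h2⟩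
          refine ⟨⟨?_, ?_⟩, ?_, ?_⟩ <;> linarith
      have hU : contBox ν (Function.update c i (x + y)) ∪
          (fun v => Pi.single i x + v) '' contBox ν (Function.update c i (y + z)) =
          contBox ν (Function.update c i (x + y + z)) := by
        ext v
        rw [Set.mem_union, mem_box_update, mem_box_update, mem_shift_box_update, ← or_and_right]
        refine and_congr_left fun _ => ?_
        constructor
        · rintro (⟨h1, h2⟩ | ⟨h1, h2⟩) <;> constructor <;> linarith
        · rintro ⟨h1, h2⟩
          rcases le_or_gt (v i) (x + y) with h | h
          · exact Or.inl ⟨h1, h⟩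
          · right; constructor <;> linarith
      have h := hC _ _ (hreg (x + y) (by positivity))
        (shift_region (Pi.single i x) _ (hreg (y + z) (by positivity))) ?_
      · rwa [hI, hU, hD _ _ (hreg (y + z) (by positivity)), hD _ _ (hreg y hy)] at h
      · rw [hI]
        exact (shift_region (Pi.single i x) _ (hreg y hy)).2.1
  have all : ∀ s : Finset (Fin ν),
      S (contBox ν (s.piecewise b a)) / ∏ j, s.piecewise b a j ≤
        S (contBox ν a) / ∏ j, a j := by
    intro s
    induction s using Finset.induction_on with
    | empty => simp
    | insert i s hi ih =>
      refine le_trans ?_ ih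
      rw [Finset.piecewise_insert]
      refine step _ i (b i) (fun j => ?_) ?_
      · by_cases hj : j ∈ s
        · simpa [hj] using hb j
        · simpa [hj] using ha j
      · simpa [hi] using hab i
  rw [contBox_volume_toReal b hb, contBox_volume_toReal a ha]
  simpa using all Finset.univ
end

section
/- Let ν be a positive integer and let S be an entropy function on the continuum ℝ^ν (satisfying axioms (A)–(D)). Then for any two boxes Λ_a ⊆ Λ_b (where a, b are ν-tuples of positive reals with aᵢ ≤ bᵢ for each i), the entropy increases: S(Λ_a) ≤ S(Λ_b). -/
open MeasureTheory

theorem region_contBox {ν : ℕ} (a : Fin ν → ℝ) (ha : ∀ i, 0 < a i) :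
    IsRegion (contBox ν a) := by
  refine ⟨MeasurableSet.univ_pi fun i => measurableSet_Ioc, ?_, ?_⟩
  · unfold contBox
    rw [volume_pi_pi]
    refine Finset.prod_ne_zero_iff.2 fun i _ => ?_
    simpa using ha i
  · unfold contBox
    rw [volume_pi_pi]
    exact ENNReal.prod_ne_top fun i _ => by simp

theorem mem_translate {ν : ℕ} (τ c x : Fin ν → ℝ) :
    x ∈ (fun x => τ + x) '' contBox ν c ↔ ∀ j, τ j < x j ∧ x j ≤ τ j + c j := by
  simp only [Set.mem_image, contBox, Set.mem_univ_pi, Set.mem_Ioc]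
  constructor
  · rintro ⟨y, hy, rfl⟩ j
    have := hy j
    simp only [Pi.add_apply]
    constructor <;> linarith
  · intro h
    refine ⟨x - τ, fun j => ?_, by simp⟩
    have := h j
    simp only [Pi.sub_apply]
    constructor <;> linarith

theorem region_translate {ν : ℕ} (τ c : Fin ν → ℝ) (hc : ∀ i, 0 < c i) :
    IsRegion ((fun x => τ + x) '' contBox ν c) := by
  obtain ⟨h1, h2, h3⟩ := region_contBox c hc
  refine ⟨?_, ?_, ?_⟩
  · exact (MeasurableEquiv.addLeft τ).measurableEmbedding.measurableSet_image.2 h1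
  · rwa [Set.image_add_left, measure_preimage_add]
  · rwa [Set.image_add_left, measure_preimage_add]

theorem pos_update {ν : ℕ} (c : Fin ν → ℝ) (hc : ∀ i, 0 < c i) (i : Fin ν) (t : ℝ)
    (ht : 0 < t) : ∀ j, 0 < Function.update c i t j := by
  intro j
  by_cases h : j = i
  · subst h; simpa using ht
  · simpa [h] using hc j

theorem step_le {ν : ℕ} (S : Set (Fin ν → ℝ) → ℝ)
    (hC : ∀ Λ₁ Λ₂ : Set (Fin ν → ℝ), IsRegion Λ₁ → IsRegion Λ₂ →
      volume (Λ₁ ∩ Λ₂) ≠ 0 → S (Λ₁ ∪ Λ₂) + S (Λ₁ ∩ Λ₂) ≤ S Λ₁ + S Λ₂)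
    (hD : ∀ (τ : Fin ν → ℝ) (Λ : Set (Fin ν → ℝ)), IsRegion Λ →
      S ((fun x => τ + x) '' Λ) = S Λ)
    (c : Fin ν → ℝ) (hc : ∀ i, 0 < c i) (i : Fin ν) (z x d : ℝ)
    (hz : 0 < z) (hzx : z ≤ x) (hd : 0 < d) :
    S (contBox ν (Function.update c i (x + d))) + S (contBox ν (Function.update c i z))
      ≤ S (contBox ν (Function.update c i x))
        + S (contBox ν (Function.update c i (z + d))) := by
  set τ : Fin ν → ℝ := Pi.single i (x - z) with hτ
  have hzd := pos_update c hc i (z + d) (by linarith)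
  have hpz := pos_update c hc i z hz
  have hpx := pos_update c hc i x (by linarith)
  have hU : contBox ν (Function.update c i x) ∪
      (fun x => τ + x) '' contBox ν (Function.update c i (z + d))
      = contBox ν (Function.update c i (x + d)) := by
    ext y
    rw [Set.mem_union, mem_translate]
    simp only [contBox, Set.mem_univ_pi, Set.mem_Ioc]
    constructor
    · rintro (h | h) j
      · have := h j
        by_cases hj : j = i
        · subst hj
          simp only [Function.update_self] at this ⊢
          constructor <;> linarith
        · simpa [hj] using this
      · have := h j
        by_cases hj : j = i
        · subst hj
          simp only [hτ, Pi.single_eq_same, Function.update_self] at this ⊢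
          constructor <;> linarith
        · simpa [hτ, hj] using this
    · intro h
      by_cases hy : y i ≤ x
      · left
        intro j
        have := h j
        by_cases hj : j = i
        · subst hj
          simp only [Function.update_self] at this ⊢
          exact ⟨this.1, hy⟩
        · simpa [hj] using this
      · right
        intro j
        have := h j
        by_cases hj : j = i
        · subst hj
          simp only [hτ, Pi.single_eq_same, Function.update_self] at this ⊢
          constructor <;> linarith
        · simpa [hτ, hj] using this
  have hI : contBox ν (Function.update c i x) ∩
      (fun x => τ + x) '' contBox ν (Function.update c i (z + d))
      = (fun x => τ + x) '' contBox ν (Function.update c i z) := by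
    ext y
    rw [Set.mem_inter_iff, mem_translate, mem_translate]
    simp only [contBox, Set.mem_univ_pi, Set.mem_Ioc]
    rw [← forall_and]
    refine forall_congr' fun j => ?_
    by_cases hj : j = i
    · subst hj
      simp only [hτ, Pi.single_eq_same, Function.update_self]
      constructor
      · rintro ⟨⟨h1, h2⟩, h3, h4⟩
        constructor <;> linarith
      · rintro ⟨h1, h2⟩
        refine ⟨⟨?_, ?_⟩, ?_, ?_⟩ <;> linarith
    · simp [hτ, hj]
  have key := hC _ _ (region_contBox _ hpx) (region_translate τ _ hzd)
    (by rw [hI]; exact (region_translate τ _ hpz).2.1)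
  rw [hU, hI, hD _ _ (region_contBox _ hpz), hD _ _ (region_contBox _ hzd)] at key
  exact key

theorem mono_coord {ν : ℕ} (S : Set (Fin ν → ℝ) → ℝ)
    (hA : ∀ Λ : Set (Fin ν → ℝ), IsRegion Λ → 0 ≤ S Λ)
    (hC : ∀ Λ₁ Λ₂ : Set (Fin ν → ℝ), IsRegion Λ₁ → IsRegion Λ₂ →
      volume (Λ₁ ∩ Λ₂) ≠ 0 → S (Λ₁ ∪ Λ₂) + S (Λ₁ ∩ Λ₂) ≤ S Λ₁ + S Λ₂)
    (hD : ∀ (τ : Fin ν → ℝ) (Λ : Set (Fin ν → ℝ)), IsRegion Λ →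
      S ((fun x => τ + x) '' Λ) = S Λ)
    (c : Fin ν → ℝ) (hc : ∀ i, 0 < c i) (i : Fin ν) (z d : ℝ)
    (hz : 0 < z) (hd : 0 < d) :
    S (contBox ν (Function.update c i z)) ≤ S (contBox ν (Function.update c i (z + d))) := by
  by_contra! hlt
  set f : ℝ → ℝ := fun t => S (contBox ν (Function.update c i t)) with hf
  have hlt' : f (z + d) < f z := hlt
  have hn : ∀ n : ℕ, f (z + n * d) ≤ f z - n * (f z - f (z + d)) := by
    intro n
    induction n with
    | zero => simp
    | succ n ih =>
      have hnd : 0 ≤ (n : ℝ) * d := by positivity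
      have h : f (z + n * d + d) + f z ≤ f (z + n * d) + f (z + d) :=
        step_le S hC hD c hc i z (z + n * d) d hz (by linarith) hd
      have e : z + ((n + 1 : ℕ) : ℝ) * d = z + n * d + d := by push_cast; ring
      rw [e]
      push_cast
      linarith
  obtain ⟨n, hn'⟩ := exists_nat_gt (f z / (f z - f (z + d)))
  rw [div_lt_iff₀ (by linarith)] at hn'
  have h0 : 0 ≤ f (z + n * d) :=
    hA _ (region_contBox _ (pos_update c hc i _ (by positivity)))
  linarith [hn n]

/-- **Theorem 2 (continuum case)**: for an entropy function on `ℝ^ν`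
satisfying positivity, subadditivity, strong subadditivity and translation
invariance (and unchanged under modification by null sets), the entropy of
boxes increases as boxes increase in the sense of set inclusion. -/
theorem entropy_monotone_continuum (ν : ℕ) (hν : 0 < ν)
    (S : Set (Fin ν → ℝ) → ℝ)
    (hNull : ∀ Λ Λ' : Set (Fin ν → ℝ), IsRegion Λ → IsRegion Λ' →
      volume (symmDiff Λ Λ') = 0 → S Λ = S Λ')
    (hA : ∀ Λ : Set (Fin ν → ℝ), IsRegion Λ → 0 ≤ S Λ)
    (hB : ∀ Λ₁ Λ₂ : Set (Fin ν → ℝ), IsRegion Λ₁ → IsRegion Λ₂ →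
      volume (Λ₁ ∩ Λ₂) = 0 → S (Λ₁ ∪ Λ₂) ≤ S Λ₁ + S Λ₂)
    (hC : ∀ Λ₁ Λ₂ : Set (Fin ν → ℝ), IsRegion Λ₁ → IsRegion Λ₂ →
      volume (Λ₁ ∩ Λ₂) ≠ 0 → S (Λ₁ ∪ Λ₂) + S (Λ₁ ∩ Λ₂) ≤ S Λ₁ + S Λ₂)
    (hD : ∀ (τ : Fin ν → ℝ) (Λ : Set (Fin ν → ℝ)), IsRegion Λ →
      S ((fun x => τ + x) '' Λ) = S Λ)
    (a b : Fin ν → ℝ) (ha : ∀ i, 0 < a i) (hb : ∀ i, 0 < b i)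
    (hab : ∀ i, a i ≤ b i) :
    S (contBox ν a) ≤ S (contBox ν b) := by
  classical
  have main : ∀ s : Finset (Fin ν),
      S (contBox ν a) ≤ S (contBox ν (s.piecewise b a)) := by
    intro s
    induction s using Finset.induction_on with
    | empty => simp
    | insert j s hj ih =>
      refine ih.trans ?_
      have hc : ∀ i, 0 < s.piecewise b a i := by
        intro i
        by_cases h : i ∈ s
        · simpa [h] using hb i
        · simpa [h] using ha i
      rw [Finset.piecewise_insert]
      have e : s.piecewise b a = Function.update (s.piecewise b a) j (a j) := by
        rw [eq_comm, Function.update_eq_self_iff]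
        simp [hj]
      rcases (hab j).eq_or_lt with h | h
      · rw [← h, ← e]
      · have := mono_coord S hA hC hD _ hc j (a j) (b j - a j) (ha j) (by linarith)
        rw [← e, add_sub_cancel] at this
        exact this
  simpa using main Finset.univ
end

section
/- Let ν be a positive integer, let S be an entropy function on the continuum ℝ^ν (satisfying axioms (A)–(D)), and let (Λ_{a(i)})_{i∈ℕ} be a sequence of boxes increasing in the sense of set inclusion (a(i)_j ≤ a(i+1)_j for all i and j). Then the sequence of mean entropies S(Λ_{a(i)})/vol(Λ_{a(i)}) converges, i.e., there exists a real number L such that S(Λ_{a(i)})/vol(Λ_{a(i)}) → L as i → ∞. -/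
open MeasureTheory Filter

/-- Discrete step: a concave sequence starting at zero has nonincreasing averages. -/
theorem aux_seq (g : ℕ → ℝ) (h0 : g 0 = 0)
    (hc : ∀ n, g (n + 2) + g n ≤ 2 * g (n + 1)) (n : ℕ) :
    (n : ℝ) * g (n + 1) ≤ (n + 1) * g n := by
  induction n with
  | zero => simp [h0]
  | succ n ih =>
    have h1 := hc n
    have h2 : ((n : ℝ) + 1) * (g (n + 2) + g n) ≤ (n + 1) * (2 * g (n + 1)) :=
      mul_le_mul_of_nonneg_left h1 (by positivity)
    push_cast
    rw [show n + 1 + 1 = n + 2 from rfl]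
    linarith

theorem aux_seq_le (g : ℕ → ℝ) (h0 : g 0 = 0)
    (hc : ∀ n, g (n + 2) + g n ≤ 2 * g (n + 1)) (m n : ℕ) (hm : 0 < m) (hmn : m ≤ n) :
    g n / n ≤ g m / m := by
  induction n, hmn using Nat.le_induction with
  | base => exact le_rfl
  | succ n hmn ih =>
    refine le_trans ?_ ih
    have hn : (0 : ℝ) < n := by exact_mod_cast lt_of_lt_of_le hm hmn
    rw [div_le_div_iff₀ (by push_cast; linarith) hn]
    have := aux_seq g h0 hc n
    push_cast
    linarith

/-- One-dimensional statement. -/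
theorem aux_real (f : ℝ → ℝ) (hpos : ∀ x, 0 < x → 0 ≤ f x)
    (hsub : ∀ x y, 0 < x → 0 < y → f (x + y) ≤ f x + f y)
    (hssa : ∀ x y z, 0 < x → 0 < y → 0 < z → f (x + y + z) + f y ≤ f (x + y) + f (y + z))
    (x y : ℝ) (hx : 0 < x) (hxy : x ≤ y) : f y * x ≤ f x * y := by
  have hmono : ∀ u v, 0 < u → u ≤ v → f u ≤ f v := by
    intro u v hu huv
    rcases huv.eq_or_lt with rfl | huv
    · exact le_rfl
    by_contra! hlt
    set h := v - u with hh
    have hhpos : 0 < h := by linarith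
    have key : ∀ n : ℕ, f (u + (n + 1) * h) - f (u + n * h) ≤ f v - f u := by
      intro n
      rcases Nat.eq_zero_or_pos n with rfl | hn
      · simp [hh]
      · have hn' : (0 : ℝ) < n := by exact_mod_cast hn
        have := hssa (n * h) u h (by positivity) hu hhpos
        have e1 : (n : ℝ) * h + u + h = u + (n + 1) * h := by ring
        have e2 : (n : ℝ) * h + u = u + n * h := by ring
        have e3 : u + h = v := by rw [hh]; ring
        rw [e1, e2, e3] at this
        linarith
    have key2 : ∀ n : ℕ, f (u + n * h) ≤ f u + n * (f v - f u) := by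
      intro n
      induction n with
      | zero => simp
      | succ n ih =>
        have := key n
        push_cast
        linarith
    obtain ⟨n, hn⟩ := exists_nat_gt (f u / (f u - f v))
    rw [div_lt_iff₀ (by linarith)] at hn
    have h1 := key2 n
    have h2 := hpos (u + n * h) (by positivity)
    linarith
  have hy : 0 < y := lt_of_lt_of_le hx hxy
  have hrat : ∀ m n : ℕ, 0 < m → m ≤ n → (m : ℝ) / n * f y ≤ f (m * (y / n)) := by
    intro m n hm hmn
    have hn : (0 : ℝ) < n := by exact_mod_cast lt_of_lt_of_le hm hmn
    have hm' : (0 : ℝ) < m := by exact_mod_cast hm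
    set h := y / n with hh
    have hhpos : 0 < h := by positivity
    have := aux_seq_le (fun k => if k = 0 then 0 else f (k * h)) (by simp) (by
      intro k
      rcases Nat.eq_zero_or_pos k with rfl | hk
      · have := hsub h h hhpos hhpos
        have e : (2 : ℝ) * h = h + h := by ring
        simp only [zero_add, if_true]
        simp
        rw [e]; linarith
      · have hk' : (0 : ℝ) < k := by exact_mod_cast hk
        have := hssa h (k * h) h hhpos (by positivity) hhpos
        have e1 : h + k * h + h = ((k + 2 : ℕ) : ℝ) * h := by push_cast; ring
        have e2 : h + k * h = ((k + 1 : ℕ) : ℝ) * h := by push_cast; ring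
        have e3 : k * h + h = ((k + 1 : ℕ) : ℝ) * h := by push_cast; ring
        rw [e1, e2, e3] at this
        simp only [hk.ne', if_false, Nat.add_eq_zero_iff]
        simp only [false_and, if_false]
        linarith) m n hm hmn
    have hn0 : n ≠ 0 := by omega
    simp only [hn0, hm.ne', if_false] at this
    have e : (n : ℝ) * h = y := by rw [hh]; field_simp
    rw [e, div_le_div_iff₀ hn hm'] at this
    rw [div_mul_eq_mul_div, div_le_iff₀ hn]
    linarith
  have hfy := hpos y hy
  have happ : ∀ n : ℕ, 0 < n → f y * x * n ≤ f x * y * n + f y * y := by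
    intro n hn
    have hn' : (0 : ℝ) < n := by exact_mod_cast hn
    have hq : 0 ≤ n * x / y := by positivity
    have hm1 := Nat.floor_le hq
    have hm2 := Nat.lt_floor_add_one (n * x / y)
    set m := ⌊n * x / y⌋₊ with hm
    rw [le_div_iff₀ hy] at hm1
    rw [div_lt_iff₀ hy] at hm2
    have hmf : (m : ℝ) * f y ≤ f x * n := by
      rcases Nat.eq_zero_or_pos m with h0 | hmpos
      · rw [h0]; simpa using mul_nonneg (hpos x hx) hn'.le
      · have hmn : m ≤ n := by
          have : (m : ℝ) ≤ n := by
            by_contra! hc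
            nlinarith
          exact_mod_cast this
        have hm' : (0 : ℝ) < m := by exact_mod_cast hmpos
        have h1 := hrat m n hmpos hmn
        have h2 := hmono (m * (y / n)) x (by positivity) (by
          rw [← mul_div_assoc, div_le_iff₀ hn']; linarith)
        have h3 := h1.trans h2
        rwa [div_mul_eq_mul_div, div_le_iff₀ hn'] at h3
    nlinarith [mul_le_mul_of_nonneg_right hmf hy.le, mul_le_mul_of_nonneg_left hm2.le hfy]
  by_contra! hlt
  obtain ⟨n, hn⟩ := exists_nat_gt (f y * y / (f y * x - f x * y))
  rw [div_lt_iff₀ (by linarith)] at hn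
  have := happ (n + 1) (by omega)
  push_cast at this
  nlinarith

theorem aux_region {ν : ℕ} (u v : Fin ν → ℝ) (h : ∀ i, u i < v i) :
    IsRegion (Set.univ.pi fun i => Set.Ioc (u i) (v i)) := by
  refine ⟨MeasurableSet.univ_pi fun i => measurableSet_Ioc, ?_, ?_⟩
  · rw [Real.volume_pi_Ioc, Finset.prod_ne_zero_iff]
    intro i _
    have := h i
    simp [this]
  · rw [Real.volume_pi_Ioc]
    exact (ENNReal.prod_lt_top fun i _ => ENNReal.ofReal_lt_top).ne

theorem aux_vol {ν : ℕ} (a : Fin ν → ℝ) (h : ∀ i, 0 < a i) :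
    (volume (contBox ν a)).toReal = ∏ i, a i := by
  have := Real.volume_pi_Ioc_toReal (a := fun _ => (0 : ℝ)) (b := a) (fun i => (h i).le)
  simpa [contBox] using this

theorem aux_translate {ν : ℕ} (τ v : Fin ν → ℝ) :
    (fun x => τ + x) '' (contBox ν v) =
      Set.univ.pi fun i => Set.Ioc (τ i) (τ i + v i) := by
  ext x
  simp only [contBox, Set.mem_image, Set.mem_univ_pi, Set.mem_Ioc]
  constructor
  · rintro ⟨y, hy, rfl⟩ i
    have := hy i
    simp only [Pi.add_apply]
    constructor <;> linarith
  · intro hx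
    refine ⟨x - τ, fun i => ?_, by simp⟩
    have := hx i
    simp only [Pi.sub_apply]
    constructor <;> linarith

/-- Mean entropy decreases when a single side of a box grows. -/
theorem aux_step (ν : ℕ)
    (S : Set (Fin ν → ℝ) → ℝ)
    (hA : ∀ Λ : Set (Fin ν → ℝ), IsRegion Λ → 0 ≤ S Λ)
    (hB : ∀ Λ₁ Λ₂ : Set (Fin ν → ℝ), IsRegion Λ₁ → IsRegion Λ₂ →
      volume (Λ₁ ∩ Λ₂) = 0 → S (Λ₁ ∪ Λ₂) ≤ S Λ₁ + S Λ₂)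
    (hC : ∀ Λ₁ Λ₂ : Set (Fin ν → ℝ), IsRegion Λ₁ → IsRegion Λ₂ →
      volume (Λ₁ ∩ Λ₂) ≠ 0 → S (Λ₁ ∪ Λ₂) + S (Λ₁ ∩ Λ₂) ≤ S Λ₁ + S Λ₂)
    (hD : ∀ (τ : Fin ν → ℝ) (Λ : Set (Fin ν → ℝ)), IsRegion Λ →
      S ((fun x => τ + x) '' Λ) = S Λ)
    (b : Fin ν → ℝ) (hb : ∀ j, 0 < b j) (j : Fin ν) (y : ℝ) (hy : b j ≤ y) :
    S (contBox ν (Function.update b j y)) /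
        (volume (contBox ν (Function.update b j y))).toReal ≤
      S (contBox ν b) / (volume (contBox ν b)).toReal := by
  have hyp : 0 < y := lt_of_lt_of_le (hb j) hy
  have hup : ∀ t, 0 < t → ∀ i, 0 < Function.update b j t i := by
    intro t ht i
    rcases eq_or_ne i j with rfl | hij
    · simpa
    · simpa [hij] using hb i
  have hreg : ∀ t, 0 < t → IsRegion (contBox ν (Function.update b j t)) := fun t ht =>
    aux_region (fun _ => 0) _ (hup t ht)
  -- translated slab
  have hmem : ∀ s t x, x ∈ (fun x => Function.update (0 : Fin ν → ℝ) j s + x) ''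
      (contBox ν (Function.update b j t)) ↔
      (s < x j ∧ x j ≤ s + t) ∧ ∀ i, i ≠ j → 0 < x i ∧ x i ≤ b i := by
    intro s t x
    rw [aux_translate]
    simp only [Set.mem_univ_pi, Set.mem_Ioc]
    constructor
    · intro h
      refine ⟨by simpa using h j, fun i hi => by simpa [hi] using h i⟩
    · rintro ⟨h1, h2⟩ i
      rcases eq_or_ne i j with rfl | hij
      · simpa using h1
      · simpa [hij] using h2 i hij
  have hmem0 : ∀ t x, x ∈ contBox ν (Function.update b j t) ↔
      (0 < x j ∧ x j ≤ t) ∧ ∀ i, i ≠ j → 0 < x i ∧ x i ≤ b i := by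
    intro t x
    have := hmem 0 t x
    simpa using this
  have hregT : ∀ s t, 0 < t → IsRegion ((fun x => Function.update (0 : Fin ν → ℝ) j s + x) ''
      (contBox ν (Function.update b j t))) := by
    intro s t ht
    rw [aux_translate]
    exact aux_region _ _ fun i => by linarith [hup t ht i]
  have main := aux_real (fun t => S (contBox ν (Function.update b j t)))
    (fun x hx => hA _ (hreg x hx))
    (by
      intro x z hx hz
      have h := hB _ _ (hreg x hx) (hregT x z hz) (by
        convert measure_empty (μ := (volume : Measure (Fin ν → ℝ)))
        ext p
        rw [Set.mem_inter_iff, hmem, hmem0]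
        simp only [Set.mem_empty_iff_false, iff_false]
        rintro ⟨⟨h1, _⟩, ⟨h2, _⟩⟩
        linarith [h1.2, h2.1])
      rw [hD _ _ (hreg z hz)] at h
      have e : contBox ν (Function.update b j (x + z)) = contBox ν (Function.update b j x) ∪
          (fun p => Function.update (0 : Fin ν → ℝ) j x + p) ''
            (contBox ν (Function.update b j z)) := by
        ext p
        rw [Set.mem_union, hmem, hmem0, hmem0, ← or_and_right]
        refine and_congr_left fun _ => ?_
        constructor
        · rintro ⟨h1, h2⟩
          rcases le_or_gt (p j) x with h3 | h3
          · exact Or.inl ⟨h1, h3⟩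
          · exact Or.inr ⟨h3, h2⟩
        · rintro (⟨h1, h2⟩ | ⟨h1, h2⟩) <;> constructor <;> linarith
      simp only [e]
      exact h)
    (by
      intro x y z hx hy hz
      have e : contBox ν (Function.update b j (x + y + z)) =
          contBox ν (Function.update b j (x + y)) ∪
          (fun p => Function.update (0 : Fin ν → ℝ) j x + p) ''
            (contBox ν (Function.update b j (y + z))) := by
        ext p
        rw [Set.mem_union, hmem, hmem0, hmem0, ← or_and_right]
        refine and_congr_left fun _ => ?_
        constructor
        · rintro ⟨h1, h2⟩
          rcases le_or_gt (p j) x with h3 | h3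
          · exact Or.inl ⟨h1, by linarith⟩
          · exact Or.inr ⟨h3, by linarith⟩
        · rintro (⟨h1, h2⟩ | ⟨h1, h2⟩) <;> constructor <;> linarith
      have e' : contBox ν (Function.update b j (x + y)) ∩
          (fun p => Function.update (0 : Fin ν → ℝ) j x + p) ''
            (contBox ν (Function.update b j (y + z))) =
          (fun p => Function.update (0 : Fin ν → ℝ) j x + p) ''
            (contBox ν (Function.update b j y)) := by
        ext p
        rw [Set.mem_inter_iff, hmem, hmem, hmem0, ← and_and_right]
        refine and_congr_left fun _ => ?_
        constructor
        · rintro ⟨⟨h1, h2⟩, h3, h4⟩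
          exact ⟨h3, h2⟩
        · rintro ⟨h1, h2⟩
          exact ⟨⟨by linarith, h2⟩, h1, by linarith⟩
      have h := hC _ _ (hreg (x + y) (by linarith)) (hregT x (y + z) (by linarith)) (by
        rw [e']; exact (hregT x y hy).2.1)
      rw [e', ← e, hD _ _ (hreg (y + z) (by linarith)), hD _ _ (hreg y hy)] at h
      exact h)
    (b j) y (hb j) hy
  simp only [Function.update_eq_self] at main
  rw [aux_vol _ hb, aux_vol _ (hup y hyp), Finset.prod_update_of_mem (Finset.mem_univ j),
    ← Finset.mul_prod_erase Finset.univ b (Finset.mem_univ j), Finset.sdiff_singleton_eq_erase]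
  have hP : 0 < ∏ i ∈ Finset.univ.erase j, b i := Finset.prod_pos fun i _ => hb i
  rw [div_le_div_iff₀ (mul_pos hyp hP) (mul_pos (hb j) hP)]
  nlinarith [mul_le_mul_of_nonneg_right main hP.le]

/-- **Corollary (continuum case)**: for an entropy function on `ℝ^ν`
satisfying positivity, subadditivity, strong subadditivity and translation
invariance (and unchanged under modification by null sets), the mean
entropies of any sequence of boxes increasing in the sense of set inclusion
converge to a limit. -/
theorem meanEntropy_tendsto_continuum (ν : ℕ) (hν : 0 < ν)
    (S : Set (Fin ν → ℝ) → ℝ)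
    (hNull : ∀ Λ Λ' : Set (Fin ν → ℝ), IsRegion Λ → IsRegion Λ' →
      volume (symmDiff Λ Λ') = 0 → S Λ = S Λ')
    (hA : ∀ Λ : Set (Fin ν → ℝ), IsRegion Λ → 0 ≤ S Λ)
    (hB : ∀ Λ₁ Λ₂ : Set (Fin ν → ℝ), IsRegion Λ₁ → IsRegion Λ₂ →
      volume (Λ₁ ∩ Λ₂) = 0 → S (Λ₁ ∪ Λ₂) ≤ S Λ₁ + S Λ₂)
    (hC : ∀ Λ₁ Λ₂ : Set (Fin ν → ℝ), IsRegion Λ₁ → IsRegion Λ₂ →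
      volume (Λ₁ ∩ Λ₂) ≠ 0 → S (Λ₁ ∪ Λ₂) + S (Λ₁ ∩ Λ₂) ≤ S Λ₁ + S Λ₂)
    (hD : ∀ (τ : Fin ν → ℝ) (Λ : Set (Fin ν → ℝ)), IsRegion Λ →
      S ((fun x => τ + x) '' Λ) = S Λ)
    (a : ℕ → Fin ν → ℝ) (ha : ∀ i j, 0 < a i j)
    (hmono : ∀ i j, a i j ≤ a (i + 1) j) :
    ∃ L : ℝ, Tendsto
      (fun i => S (contBox ν (a i)) / (volume (contBox ν (a i))).toReal)
      atTop (nhds L) := by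
  set F : (Fin ν → ℝ) → ℝ := fun a => S (contBox ν a) / (volume (contBox ν a)).toReal with hF
  have hle : ∀ p q : Fin ν → ℝ, (∀ j, 0 < p j) → (∀ j, p j ≤ q j) → F q ≤ F p := by
    intro p q hp hpq
    have hind : ∀ s : Finset (Fin ν), F (s.piecewise q p) ≤ F p := by
      intro s
      induction s using Finset.induction_on with
      | empty => simp
      | insert j s hj ih =>
        refine le_trans ?_ ih
        rw [Finset.piecewise_insert]
        refine aux_step ν S hA hB hC hD _ ?_ j (q j) ?_
        · intro i
          by_cases hi : i ∈ s
          · simpa [hi] using lt_of_lt_of_le (hp i) (hpq i)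
          · simpa [hi] using hp i
        · simpa [hj] using hpq j
    simpa using hind Finset.univ
  have hanti : Antitone fun i => F (a i) :=
    antitone_nat_of_succ_le fun i => hle _ _ (ha i) (hmono i)
  refine ⟨_, tendsto_atTop_ciInf hanti ⟨0, ?_⟩⟩
  rintro _ ⟨i, rfl⟩
  exact div_nonneg (hA _ (aux_region (fun _ => 0) _ (ha i))) ENNReal.toReal_nonneg
end

section
/- Let S be a real-valued function on the positive integers satisfying S(q + r) ≤ S(q) + S(r) and S(q + r + t) + S(r) ≤ S(q + r) + S(r + t) for all positive integers q, r, t. Then the sequence S(n)/n is monotonically decreasing: for every positive integer n, S(n)/n ≥ S(n+1)/(n+1). -/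
/-- **Case 1 (one-dimensional lattice)**: if `S` on the positive integers is
subadditive and strongly subadditive, then the mean entropy `S(n)/n` is
monotonically decreasing. -/
theorem meanEntropy_antitone_oneDim_lattice (S : ℕ → ℝ)
    (hB : ∀ q r : ℕ, 0 < q → 0 < r → S (q + r) ≤ S q + S r)
    (hC : ∀ q r t : ℕ, 0 < q → 0 < r → 0 < t →
      S (q + r + t) + S r ≤ S (q + r) + S (r + t)) :
    ∀ n : ℕ, 0 < n → S (n + 1) / ((n : ℝ) + 1) ≤ S n / (n : ℝ) := by
  have key : ∀ n : ℕ, 0 < n → (n : ℝ) * S (n + 1) ≤ ((n : ℝ) + 1) * S n := by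
    intro n hn
    induction n, hn using Nat.le_induction with
    | base =>
      have h := hB 1 1 one_pos one_pos
      norm_num at h ⊢
      linarith
    | succ n hn ih =>
      have h := hC 1 n 1 one_pos hn one_pos
      rw [Nat.add_comm 1 n] at h
      have hp : (0 : ℝ) ≤ (n : ℝ) + 1 := by positivity
      have h2 := mul_le_mul_of_nonneg_left h hp
      push_cast
      linarith
  intro n hn
  have hn' : (0 : ℝ) < n := by exact_mod_cast hn
  rw [div_le_div_iff₀ (by positivity) hn']
  have := key n hn
  linarith
end

section
/- Let S be a real-valued function on the positive reals satisfying S(x) ≥ 0 for all x > 0, S(q + r) ≤ S(q) + S(r) for all reals q, r > 0, and S(q + r + t) + S(r) ≤ S(q + r) + S(r + t) for all reals q, r, t > 0. Then S(x)/x is monotonically decreasing: for all positive reals y ≤ x, S(y)/y ≥ S(x)/x. -/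
/-- **Case 3 (one-dimensional continuum)**: if `S` on the positive reals is
positive, subadditive and strongly subadditive, then the mean entropy
`S(x)/x` is monotonically decreasing. -/
theorem meanEntropy_antitone_oneDim_continuum (S : ℝ → ℝ)
    (hA : ∀ x : ℝ, 0 < x → 0 ≤ S x)
    (hB : ∀ q r : ℝ, 0 < q → 0 < r → S (q + r) ≤ S q + S r)
    (hC : ∀ q r t : ℝ, 0 < q → 0 < r → 0 < t →
      S (q + r + t) + S r ≤ S (q + r) + S (r + t)) :
    ∀ x y : ℝ, 0 < y → y ≤ x → S x / x ≤ S y / y := by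
  have incr : ∀ a q : ℝ, 0 < a → 0 < q → S a ≤ S (a + q) := by
    intro a q ha hq
    have key : ∀ n : ℕ, S (a + (n + 1) * q) ≤ S a + (n + 1) * (S (a + q) - S a) := by
      intro n
      induction n with
      | zero => simp
      | succ k ih =>
        have h := hC ((k + 1) * q) a q (by positivity) ha hq
        have e1 : (k + 1) * q + a + q = a + (((k + 1 : ℕ) : ℝ) + 1) * q := by push_cast; ring
        have e2 : (k + 1) * q + a = a + (k + 1) * q := by ring
        rw [e1, e2] at h
        push_cast at h ⊢
        linarith
    by_contra hlt
    push Not at hlt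
    have hd : 0 < S a - S (a + q) := by linarith
    obtain ⟨n, hn⟩ := exists_nat_gt (S a / (S a - S (a + q)))
    rw [div_lt_iff₀ hd] at hn
    have h1 := key n
    have h2 := hA (a + (n + 1) * q) (by positivity)
    nlinarith
  have step : ∀ h : ℝ, 0 < h → ∀ k : ℕ,
      ((k : ℝ) + 1) * S ((k + 2) * h) ≤ (k + 2) * S ((k + 1) * h) := by
    intro h hh k
    induction k with
    | zero =>
      have := hB h h hh hh
      rw [← two_mul] at this
      simp
      linarith
    | succ k ih =>
      have h1 := hC h ((k + 1) * h) h hh (by positivity) hh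
      have e1 : h + (k + 1) * h + h = (k + 1 + 2) * h := by ring
      have e2 : h + (k + 1) * h = (k + 2) * h := by ring
      have e3 : (k + 1) * h + h = (k + 2) * h := by ring
      have e4 : ((k : ℝ) + 1 + 1) * h = (k + 2) * h := by ring
      rw [e1, e2, e3] at h1
      push_cast
      rw [e4]
      have hk : (0 : ℝ) ≤ k := k.cast_nonneg
      have h2 := mul_le_mul_of_nonneg_left h1 (by positivity : (0 : ℝ) ≤ (k : ℝ) + 2)
      linarith
  have mult : ∀ h : ℝ, 0 < h → ∀ m n : ℕ, 1 ≤ m → m ≤ n →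
      (m : ℝ) * S (n * h) ≤ n * S (m * h) := by
    intro h hh m n hm hmn
    induction n, hmn using Nat.le_induction with
    | base => exact le_rfl
    | succ n hn ih =>
      obtain ⟨k, rfl⟩ : ∃ k, n = k + 1 := ⟨n - 1, by omega⟩
      have h1 := step h hh k
      have hk : (0 : ℝ) < (k : ℝ) + 1 := by positivity
      have e4 : ((k : ℝ) + 1 + 1) = k + 2 := by ring
      push_cast at ih ⊢
      rw [e4]
      have h2 := mul_le_mul_of_nonneg_left h1 (Nat.cast_nonneg (α := ℝ) m)
      have h3 := mul_le_mul_of_nonneg_left ih (by positivity : (0 : ℝ) ≤ (k : ℝ) + 2)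
      refine le_of_mul_le_mul_left ?_ hk
      linarith
  intro x y hy hyx
  have hx : 0 < x := lt_of_lt_of_le hy hyx
  rw [div_le_div_iff₀ hx hy]
  by_contra hlt
  push Not at hlt
  have hSy := hA y hy
  have hSx : 0 < S x := by
    by_contra h0
    push Not at h0
    nlinarith [mul_nonneg hSy hx.le]
  have hc : S y / S x < y / x := by
    rw [div_lt_div_iff₀ hSx hx]; linarith
  obtain ⟨p, hp1, hp2⟩ := exists_rat_btwn hc
  have hp0 : 0 < p := by
    have : (0 : ℝ) < p := lt_of_le_of_lt (by positivity) hp1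
    exact_mod_cast this
  obtain ⟨m, hm⟩ : ∃ m : ℕ, p.num = m := ⟨p.num.toNat, by
    have := Rat.num_pos.2 hp0
    omega⟩
  have hm1 : 1 ≤ m := by
    have := Rat.num_pos.2 hp0
    omega
  have hn0 : (0 : ℝ) < p.den := by exact_mod_cast p.den_pos
  have hpe : (p : ℝ) = m / p.den := by
    rw [Rat.cast_def, hm]; simp
  rw [hpe] at hp1 hp2
  rw [div_lt_div_iff₀ hn0 hx] at hp2
  rw [div_lt_div_iff₀ hSx hn0] at hp1
  have hmn : m ≤ p.den := by
    by_contra hcon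
    push Not at hcon
    have : (p.den : ℝ) < m := by exact_mod_cast hcon
    nlinarith
  have hmr : (0 : ℝ) < m := by exact_mod_cast hm1
  have h1 := mult (x / p.den) (by positivity) m p.den hm1 hmn
  rw [mul_div_cancel₀ _ hn0.ne'] at h1
  have hlt2 : m * (x / p.den) < y := by
    rw [← mul_div_assoc, div_lt_iff₀ hn0]; exact hp2
  have h2 := incr (m * (x / p.den)) (y - m * (x / p.den)) (by positivity) (by linarith)
  rw [add_sub_cancel] at h2
  have h3 := mul_le_mul_of_nonneg_left h2 hn0.le
  linarith
end

section
/- (Lieb) Let S be a real-valued function on the positive reals satisfying S(q + r + t) + S(r) ≤ S(q + r) + S(r + t) for all positive reals q, r, t. Then S is weakly (midpoint) concave: for all positive reals x and y, S((x + y)/2) ≥ S(x)/2 + S(y)/2. -/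
/-- **Lemma (Lieb)**: if `S` on the positive reals is strongly subadditive,
then `S` is weakly (midpoint) concave. -/
theorem weakly_concave_of_ssa (S : ℝ → ℝ)
    (hC : ∀ q r t : ℝ, 0 < q → 0 < r → 0 < t →
      S (q + r + t) + S r ≤ S (q + r) + S (r + t)) :
    ∀ x y : ℝ, 0 < x → 0 < y → S x / 2 + S y / 2 ≤ S ((x + y) / 2) := by
  have key : ∀ x y : ℝ, 0 < x → x < y → S x / 2 + S y / 2 ≤ S ((x + y) / 2) := by
    intro x y hx hxy
    have h := hC ((y - x) / 2) x ((y - x) / 2) (by linarith) hx (by linarith)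
    rw [show (y - x) / 2 + x + (y - x) / 2 = y by ring,
      show (y - x) / 2 + x = (x + y) / 2 by ring,
      show x + (y - x) / 2 = (x + y) / 2 by ring] at h
    linarith
  intro x y hx hy
  rcases lt_trichotomy x y with h | h | h
  · exact key x y hx h
  · subst h
    rw [show (x + x) / 2 = x by ring]
    linarith
  · have := key y x hy h
    rw [add_comm x y]
    linarith
end

section
/- Let ν be a positive integer and let S be a map from nonempty finite subsets of ℤ^ν to ℝ satisfying subadditivity and strong subadditivity (axioms (B) and (C); neither positivity nor translation invariance is assumed). Then for every finite subset F of ℤ^ν with |F| = n ≥ 2, the mean entropy of F is at most the average of the mean entropies of its subsets obtained by deleting one point: S(F)/n ≤ (1/n) · Σ_{j ∈ F} [ S(F \ {j})/(n − 1) ]. -/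
open Finset

/-- **Theorem 3**: for a map `S` on nonempty finite subsets of `ℤ^ν`
satisfying subadditivity and strong subadditivity, the mean entropy of a
figure of `n ≥ 2` cubes is at most the average of the mean entropies of its
subfigures obtained by deleting one cube. -/
theorem meanEntropy_le_average_of_deletions (ν : ℕ) (hν : 0 < ν)
    (S : Finset (Fin ν → ℤ) → ℝ)
    (hB : ∀ Λ₁ Λ₂ : Finset (Fin ν → ℤ), Λ₁.Nonempty → Λ₂.Nonempty →
      Disjoint Λ₁ Λ₂ → S (Λ₁ ∪ Λ₂) ≤ S Λ₁ + S Λ₂)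
    (hC : ∀ Λ₁ Λ₂ : Finset (Fin ν → ℤ), (Λ₁ ∩ Λ₂).Nonempty →
      S (Λ₁ ∪ Λ₂) + S (Λ₁ ∩ Λ₂) ≤ S Λ₁ + S Λ₂)
    (F : Finset (Fin ν → ℤ)) (hF : 2 ≤ F.card) :
    S F / (F.card : ℝ) ≤
      (1 / (F.card : ℝ)) * ∑ j ∈ F, S (F.erase j) / ((F.card : ℝ) - 1) := by
  classical
  obtain ⟨T, hT⟩ : ∃ T : Finset (Fin ν → ℤ) → ℝ, T = fun A => if A = ∅ then 0 else S A :=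
    ⟨_, rfl⟩
  have hT0 : T ∅ = 0 := by simp [hT]
  have hTS : ∀ A : Finset (Fin ν → ℤ), A.Nonempty → T A = S A := by
    intro A hA
    simp [hT, hA.ne_empty]
  have hsub : ∀ A B : Finset (Fin ν → ℤ), T (A ∪ B) + T (A ∩ B) ≤ T A + T B := by
    intro A B
    rcases A.eq_empty_or_nonempty with rfl | hA
    · simp [add_comm]
    rcases B.eq_empty_or_nonempty with rfl | hB'
    · simp
    rcases (A ∩ B).eq_empty_or_nonempty with h | h
    · rw [h, hT0, hTS A hA, hTS B hB', hTS _ (hA.mono subset_union_left), add_zero]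
      exact hB A B hA hB' (disjoint_iff_inter_eq_empty.mpr h)
    · rw [hTS A hA, hTS B hB', hTS _ (hA.mono subset_union_left), hTS _ h]
      exact hC A B h
  have key : ∀ A : Finset (Fin ν → ℤ), A ⊆ F →
      ((A.card : ℝ) - 1) * T F + T (F \ A) ≤ ∑ j ∈ A, T (F.erase j) := by
    intro A
    induction A using Finset.induction_on with
    | empty => intro _; simp
    | insert a A ha ih =>
      intro h
      have h1 := ih ((subset_insert a A).trans h)
      have haF : a ∈ F := h (mem_insert_self a A)
      have h2 := hsub (F \ A) (F.erase a)
      have e1 : (F \ A) ∪ F.erase a = F := by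
        ext x
        by_cases hx : x = a
        · subst hx; simp [ha, haF]
        · simp [hx]; tauto
      have e2 : (F \ A) ∩ F.erase a = F \ insert a A := by
        ext x
        simp
        tauto
      rw [e1, e2] at h2
      rw [sum_insert ha, card_insert_of_notMem ha]
      push_cast
      linarith
  have hk := key F Subset.rfl
  have hne : F.Nonempty := card_pos.mp (by omega)
  have hsum : ∑ j ∈ F, T (F.erase j) = ∑ j ∈ F, S (F.erase j) := by
    refine sum_congr rfl fun j hj => hTS _ (card_pos.mp ?_)
    rw [card_erase_of_mem hj]
    omega
  rw [hsum, sdiff_self, hTS F hne] at hk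
  have hT0' : T (⊥ : Finset (Fin ν → ℤ)) = 0 := hT0
  have hn : (2 : ℝ) ≤ F.card := by exact_mod_cast hF
  rw [← sum_div, one_div, inv_mul_eq_div]
  refine div_le_div_of_nonneg_right ?_ (by linarith)
  rw [le_div_iff₀ (by linarith)]
  linarith
end

section
/- Let ν be a positive integer and let S be a map from nonempty finite subsets of ℤ^ν to ℝ satisfying subadditivity and strong subadditivity (axioms (B) and (C)). Then for every finite subset F of ℤ^ν with |F| = n ≥ 2 there exists j ∈ F such that S(F)/n ≤ S(F \ {j})/(n − 1); equivalently, S(F)/n ≤ max_{j ∈ F} S(F \ {j})/(n − 1). -/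
open Finset

/-- **Corollary**: for a map `S` on nonempty finite subsets of `ℤ^ν`
satisfying subadditivity and strong subadditivity, the mean entropy of a
figure of `n ≥ 2` cubes is at most the mean entropy of at least one of its
subfigures obtained by deleting one cube. -/
theorem meanEntropy_le_max_of_deletions (ν : ℕ) (hν : 0 < ν)
    (S : Finset (Fin ν → ℤ) → ℝ)
    (hB : ∀ Λ₁ Λ₂ : Finset (Fin ν → ℤ), Λ₁.Nonempty → Λ₂.Nonempty →
      Disjoint Λ₁ Λ₂ → S (Λ₁ ∪ Λ₂) ≤ S Λ₁ + S Λ₂)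
    (hC : ∀ Λ₁ Λ₂ : Finset (Fin ν → ℤ), (Λ₁ ∩ Λ₂).Nonempty →
      S (Λ₁ ∪ Λ₂) + S (Λ₁ ∩ Λ₂) ≤ S Λ₁ + S Λ₂)
    (F : Finset (Fin ν → ℤ)) (hF : 2 ≤ F.card) :
    ∃ j ∈ F, S F / (F.card : ℝ) ≤ S (F.erase j) / ((F.card : ℝ) - 1) := by
  classical
  obtain ⟨T, hT0, hTS⟩ : ∃ T : Finset (Fin ν → ℤ) → ℝ, T ∅ = 0 ∧
      ∀ A : Finset (Fin ν → ℤ), A.Nonempty → T A = S A :=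
    ⟨fun A => if A = ∅ then 0 else S A, by simp, fun A hA => by simp [hA.ne_empty]⟩
  have hsub : ∀ A B : Finset (Fin ν → ℤ), T (A ∪ B) + T (A ∩ B) ≤ T A + T B := by
    intro A B
    rcases A.eq_empty_or_nonempty with rfl | hA
    · simp [hT0]
    rcases B.eq_empty_or_nonempty with rfl | hB'
    · simp [hT0]
    rw [hTS A hA, hTS B hB', hTS (A ∪ B) (hA.mono subset_union_left)]
    rcases (A ∩ B).eq_empty_or_nonempty with h | h
    · rw [h, hT0, add_zero]
      exact hB A B hA hB' (disjoint_iff_inter_eq_empty.mpr h)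
    · rw [hTS _ h]
      exact hC A B h
  have key : ∀ J : Finset (Fin ν → ℤ), J ⊆ F →
      ((J.card : ℝ) - 1) * T F + T (F \ J) ≤ ∑ j ∈ J, T (F.erase j) := by
    intro J
    induction J using Finset.induction_on with
    | empty => intro _; simp
    | insert k J hk ih =>
      intro hJ
      have h1 := ih ((subset_insert k J).trans hJ)
      have hkF : k ∈ F := hJ (mem_insert_self k J)
      have h2 := hsub (F.erase k) (F \ J)
      have e1 : F.erase k ∪ (F \ J) = F := by
        ext x; simp only [mem_union, mem_erase, mem_sdiff]; grind
      have e2 : F.erase k ∩ (F \ J) = F \ insert k J := by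
        ext x; simp only [mem_inter, mem_erase, mem_sdiff, mem_insert]; grind
      rw [e1, e2] at h2
      rw [sum_insert hk, card_insert_of_notMem hk]
      push_cast
      linarith
  have hfin := key F Subset.rfl
  rw [sdiff_self, Finset.bot_eq_empty, hT0, add_zero] at hfin
  have hn : (2 : ℝ) ≤ F.card := by exact_mod_cast hF
  have hne : F.Nonempty := card_pos.mp (by omega)
  have hsum : ∑ _j ∈ F, (((F.card : ℝ) - 1) * T F / F.card) ≤ ∑ j ∈ F, T (F.erase j) := by
    rw [sum_const, nsmul_eq_mul, mul_div_cancel₀ _ (by linarith)]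
    exact hfin
  obtain ⟨j, hj, hle⟩ := exists_le_of_sum_le hne hsum
  refine ⟨j, hj, ?_⟩
  have hej : (F.erase j).Nonempty := card_pos.mp (by rw [card_erase_of_mem hj]; omega)
  rw [hTS F hne, hTS _ hej] at hle
  rw [le_div_iff₀ (by linarith)]
  calc S F / F.card * ((F.card : ℝ) - 1) = ((F.card : ℝ) - 1) * S F / F.card := by ring
    _ ≤ _ := hle
end

section
/- Let S be a real-valued function on the positive integers satisfying S(n) ≥ 0, S(q + r) ≤ S(q) + S(r), and S(q + r + t) + S(r) ≤ S(q + r) + S(r + t) for all positive integers n, q, r, t. Then the limit L = lim_{n→∞} S(n)/n exists, and for every integer N ≥ 2 the entropy increment dominates the limiting mean entropy: S(N) − S(N − 1) ≥ L. In particular, since L ≥ 0, the sequence S(N) is monotonically increasing. -/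
open Filter

/-- For `S` on the positive integers satisfying positivity, subadditivity and
strong subadditivity: the limiting mean entropy `L = lim S(n)/n` exists, the
entropy increment `S(N) - S(N-1)` dominates `L` for every `N ≥ 2`, and (since
`L ≥ 0`) the entropy is monotonically increasing. -/
theorem entropy_increment_ge_limiting_mean_entropy (S : ℕ → ℝ)
    (hA : ∀ n : ℕ, 0 < n → 0 ≤ S n)
    (hB : ∀ q r : ℕ, 0 < q → 0 < r → S (q + r) ≤ S q + S r)
    (hC : ∀ q r t : ℕ, 0 < q → 0 < r → 0 < t →
      S (q + r + t) + S r ≤ S (q + r) + S (r + t)) :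
    ∃ L : ℝ, Tendsto (fun n : ℕ => S n / (n : ℝ)) atTop (nhds L) ∧
      (∀ N : ℕ, 2 ≤ N → L ≤ S N - S (N - 1)) ∧
      (∀ N : ℕ, 2 ≤ N → S (N - 1) ≤ S N) := by
  have hu : Subadditive (fun n : ℕ => if n = 0 then (0 : ℝ) else S n) := by
    intro m n
    rcases Nat.eq_zero_or_pos m with rfl | hm
    · simp
    rcases Nat.eq_zero_or_pos n with rfl | hn
    · simp
    have h1 : m ≠ 0 := by omega
    have h2 : n ≠ 0 := by omega
    have h3 : m + n ≠ 0 := by omega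
    simp only [h1, h2, h3, if_false]
    exact hB m n hm hn
  have hbdd : BddBelow (Set.range fun n : ℕ =>
      (if n = 0 then (0 : ℝ) else S n) / (n : ℝ)) := by
    refine ⟨0, ?_⟩
    rintro _ ⟨n, rfl⟩
    rcases Nat.eq_zero_or_pos n with rfl | hn
    · simp
    have h2 : n ≠ 0 := by omega
    simp only [h2, if_false]
    exact div_nonneg (hA n hn) (Nat.cast_nonneg n)
  have hlim : Tendsto (fun n : ℕ => S n / (n : ℝ)) atTop (nhds hu.lim) := by
    refine (hu.tendsto_lim hbdd).congr fun n => ?_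
    rcases Nat.eq_zero_or_pos n with rfl | hn
    · simp
    have h2 : n ≠ 0 := by omega
    simp only [h2, if_false]
  have hL0 : 0 ≤ hu.lim := by
    refine ge_of_tendsto hlim ?_
    filter_upwards [eventually_gt_atTop 0] with n hn
    exact div_nonneg (hA n hn) (Nat.cast_nonneg n)
  have hmain : ∀ m : ℕ, 0 < m → hu.lim ≤ S (m + 1) - S m := by
    intro m hm
    have hD : ∀ k : ℕ, S (m + k + 1) - S (m + k) ≤ S (m + 1) - S m := by
      intro k
      induction k with
      | zero => simp
      | succ k ih =>
        have h := hC 1 (m + k) 1 one_pos (by omega) one_pos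
        rw [show 1 + (m + k) + 1 = m + (k + 1) + 1 by ring,
          show 1 + (m + k) = m + k + 1 by ring] at h
        rw [show m + (k + 1) = m + k + 1 by ring] at h ⊢
        linarith
    have hS : ∀ k : ℕ, S (m + k) ≤ S m + k * (S (m + 1) - S m) := by
      intro k
      induction k with
      | zero => simp
      | succ k ih =>
        have h := hD k
        rw [← add_assoc]
        push_cast
        linarith
    have ht : Tendsto (fun n : ℕ => (S m - m * (S (m + 1) - S m)) / (n : ℝ)
        + (S (m + 1) - S m)) atTop (nhds (0 + (S (m + 1) - S m))) :=
      (tendsto_const_div_atTop_nhds_zero_nat _).add_const _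
    rw [zero_add] at ht
    refine le_of_tendsto_of_tendsto hlim ht ?_
    filter_upwards [eventually_ge_atTop m] with n hn
    obtain ⟨k, rfl⟩ := Nat.exists_eq_add_of_le hn
    have hp : (0 : ℝ) < ((m + k : ℕ) : ℝ) := by
      exact_mod_cast (by omega : 0 < m + k)
    rw [div_add' _ _ _ hp.ne']
    refine div_le_div_of_nonneg_right ?_ hp.le
    have h := hS k
    push_cast
    linarith
  have hinc : ∀ N : ℕ, 2 ≤ N → hu.lim ≤ S N - S (N - 1) := by
    intro N hN
    have h := hmain (N - 1) (by omega)
    rwa [show N - 1 + 1 = N by omega] at h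
  refine ⟨hu.lim, hlim, hinc, fun N hN => ?_⟩
  have h := hinc N hN
  linarith
end

section
/- Let S be a real-valued function on the positive integers satisfying S(q + r) ≤ S(q) + S(r) and S(q + r + t) + S(r) ≤ S(q + r) + S(r + t) for all positive integers q, r, t. Define the m-point correlation entropies by S^c_2 = 2S(1) − S(2) and S^c_m = 2S(m−1) − S(m−2) − S(m) for m ≥ 3. Then S^c_m ≥ 0 for every m ≥ 2, and for every positive integer n the entropy of n consecutive points satisfies S(n) = n·S(1) − Σ_{m=2}^{n} (n + 1 − m)·S^c_m; equivalently, the index of correlation I_n = n·S(1) − S(n) equals Σ_{m=2}^{n} (n + 1 − m)·S^c_m and is nonnegative. -/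
open Finset

/-- The `m`-point correlation entropies of a translationally invariant state
on the one-dimensional lattice, defined for `m ≥ 2` by
`S^c_2 = 2S(1) - S(2)` and `S^c_m = 2S(m-1) - S(m-2) - S(m)` for `m ≥ 3`. -/
noncomputable def corrEntropy (S : ℕ → ℝ) (m : ℕ) : ℝ :=
  if m = 2 then 2 * S 1 - S 2 else 2 * S (m - 1) - S (m - 2) - S m

/-- For `S` on the positive integers satisfying subadditivity and strong
subadditivity: the `m`-point correlation entropies `S^c_m` are nonnegative,
`S(n) = n·S(1) - ∑_{m=2}^{n} (n+1-m)·S^c_m` for every `n ≥ 1`; equivalently,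
the index of correlation `I_n = n·S(1) - S(n)` equals
`∑_{m=2}^{n} (n+1-m)·S^c_m` and is nonnegative. -/
theorem corrEntropy_nonneg_and_entropy_expansion (S : ℕ → ℝ)
    (hB : ∀ q r : ℕ, 0 < q → 0 < r → S (q + r) ≤ S q + S r)
    (hC : ∀ q r t : ℕ, 0 < q → 0 < r → 0 < t →
      S (q + r + t) + S r ≤ S (q + r) + S (r + t)) :
    (∀ m : ℕ, 2 ≤ m → 0 ≤ corrEntropy S m) ∧
    (∀ n : ℕ, 0 < n →
      S n = (n : ℝ) * S 1 -
        ∑ m ∈ Finset.Icc 2 n, ((n : ℝ) + 1 - (m : ℝ)) * corrEntropy S m) ∧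
    (∀ n : ℕ, 0 < n →
      (n : ℝ) * S 1 - S n =
        ∑ m ∈ Finset.Icc 2 n, ((n : ℝ) + 1 - (m : ℝ)) * corrEntropy S m) ∧
    (∀ n : ℕ, 0 < n → 0 ≤ (n : ℝ) * S 1 - S n) := by
  have h1 : ∀ m : ℕ, 2 ≤ m → 0 ≤ corrEntropy S m := by
    intro m hm
    unfold corrEntropy
    split_ifs with h
    · have := hB 1 1 one_pos one_pos
      norm_num at this
      linarith
    · obtain ⟨r, rfl⟩ : ∃ r, m = 1 + (r + 1) + 1 := ⟨m - 3, by omega⟩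
      have := hC 1 (r + 1) 1 one_pos (by omega) one_pos
      have e1 : 1 + (r + 1) + 1 - 1 = 1 + (r + 1) := by omega
      have e2 : 1 + (r + 1) + 1 - 2 = r + 1 := by omega
      have e3 : r + 1 + 1 = 1 + (r + 1) := by omega
      rw [e1, e2]
      rw [e3] at this
      linarith
  have hD : ∀ k : ℕ, ∑ m ∈ Finset.Icc 2 (k + 2), corrEntropy S m
      = S 1 + S (k + 1) - S (k + 2) := by
    intro k
    induction k with
    | zero => simp [corrEntropy]; ring
    | succ k ih =>
      rw [show k + 1 + 2 = (k + 2) + 1 by omega,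
        Finset.sum_Icc_succ_top (by omega), ih]
      have : corrEntropy S (k + 2 + 1) = 2 * S (k + 2) - S (k + 1) - S (k + 2 + 1) := by
        unfold corrEntropy
        rw [if_neg (by omega)]
        rfl
      rw [this, show k + 1 + 1 = k + 2 by omega]
      ring
  have h3 : ∀ k : ℕ, ((k + 1 : ℕ) : ℝ) * S 1 - S (k + 1) =
      ∑ m ∈ Finset.Icc 2 (k + 1), (((k + 1 : ℕ) : ℝ) + 1 - (m : ℝ)) * corrEntropy S m := by
    intro k
    induction k with
    | zero => simp
    | succ k ih =>
      have hd := hD k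
      rw [Finset.sum_Icc_succ_top (by omega)] at hd ⊢
      have e : ∑ m ∈ Finset.Icc 2 (k + 1),
            (((k + 1 + 1 : ℕ) : ℝ) + 1 - (m : ℝ)) * corrEntropy S m
          = ∑ m ∈ Finset.Icc 2 (k + 1),
              (((k + 1 : ℕ) : ℝ) + 1 - (m : ℝ)) * corrEntropy S m
            + ∑ m ∈ Finset.Icc 2 (k + 1), corrEntropy S m := by
        rw [← Finset.sum_add_distrib]
        refine Finset.sum_congr rfl fun m _ => ?_
        push_cast
        ring
      rw [e, ← ih]
      push_cast
      linarith
  have h3' : ∀ n : ℕ, 0 < n → (n : ℝ) * S 1 - S n =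
      ∑ m ∈ Finset.Icc 2 n, ((n : ℝ) + 1 - (m : ℝ)) * corrEntropy S m := by
    intro n hn
    obtain ⟨k, rfl⟩ : ∃ k, n = k + 1 := ⟨n - 1, by omega⟩
    exact h3 k
  refine ⟨h1, fun n hn => ?_, h3', fun n hn => ?_⟩
  · rw [← h3' n hn]
    ring
  · rw [h3' n hn]
    refine Finset.sum_nonneg fun m hm => ?_
    rw [Finset.mem_Icc] at hm
    have : (m : ℝ) ≤ n := by exact_mod_cast hm.2
    exact mul_nonneg (by linarith) (h1 m hm.1)
end

section
/- Let S be a map from nonempty finite subsets of ℤ² to ℝ satisfying subadditivity, strong subadditivity, and invariance under every isometry of ℤ² (every bijection of ℤ² preserving Euclidean distance, i.e., compositions of translations, rotations by multiples of 90°, and reflections). Then the mean entropy of the L-shaped tromino is at most the mean entropy of the domino: S({(0,0),(1,0),(0,1)})/3 ≤ S({(0,0),(1,0)})/2. -/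
/-- A bijection of `ℤ²` preserving Euclidean distance (equivalently,
preserving the squared Euclidean distance, which is integer-valued). -/
def IsLatticeIsometry (f : ℤ × ℤ → ℤ × ℤ) : Prop :=
  Function.Bijective f ∧
    ∀ x y : ℤ × ℤ, ((f x).1 - (f y).1) ^ 2 + ((f x).2 - (f y).2) ^ 2 =
      (x.1 - y.1) ^ 2 + (x.2 - y.2) ^ 2

/-- For `S` on nonempty finite subsets of `ℤ²` satisfying subadditivity,
strong subadditivity and invariance under every isometry of `ℤ²`, the mean
entropy of the L-shaped tromino is at most the mean entropy of the domino. -/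
theorem meanEntropy_tromino_le_domino (S : Finset (ℤ × ℤ) → ℝ)
    (hB : ∀ Λ₁ Λ₂ : Finset (ℤ × ℤ), Λ₁.Nonempty → Λ₂.Nonempty →
      Disjoint Λ₁ Λ₂ → S (Λ₁ ∪ Λ₂) ≤ S Λ₁ + S Λ₂)
    (hC : ∀ Λ₁ Λ₂ : Finset (ℤ × ℤ), (Λ₁ ∩ Λ₂).Nonempty →
      S (Λ₁ ∪ Λ₂) + S (Λ₁ ∩ Λ₂) ≤ S Λ₁ + S Λ₂)
    (hD : ∀ f : ℤ × ℤ → ℤ × ℤ, IsLatticeIsometry f →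
      ∀ Λ : Finset (ℤ × ℤ), Λ.Nonempty → S (Λ.image f) = S Λ) :
    S ({((0 : ℤ), (0 : ℤ)), (1, 0), (0, 1)} : Finset (ℤ × ℤ)) / 3 ≤
      S ({((0 : ℤ), (0 : ℤ)), (1, 0)} : Finset (ℤ × ℤ)) / 2 := by
  have hswap : IsLatticeIsometry Prod.swap :=
    ⟨Prod.swap_bijective, fun x y => by simp only [Prod.fst_swap, Prod.snd_swap]; ring⟩
  have htrans : IsLatticeIsometry (fun x => x + (1, 0)) :=
    ⟨(Equiv.addRight ((1 : ℤ), (0 : ℤ))).bijective, fun x y => by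
      simp only [Prod.fst_add, Prod.snd_add]; ring⟩
  -- the vertical domino and the second single site
  have h1 := hD _ hswap {((0 : ℤ), (0 : ℤ)), (1, 0)} (by simp)
  have h2 := hD _ htrans {((0 : ℤ), (0 : ℤ))} (by simp)
  rw [show Finset.image Prod.swap ({((0 : ℤ), (0 : ℤ)), (1, 0)} : Finset (ℤ × ℤ))
      = {(0, 0), (0, 1)} by decide] at h1
  rw [show Finset.image (fun x : ℤ × ℤ => x + (1, 0)) {((0 : ℤ), (0 : ℤ))} = {(1, 0)} by decide]
    at h2
  have h3 := hB {((0 : ℤ), (0 : ℤ))} {(1, 0)} (by simp) (by simp) (by simp)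
  rw [show ({((0 : ℤ), (0 : ℤ))} ∪ {(1, 0)} : Finset (ℤ × ℤ)) = {(0, 0), (1, 0)} by decide] at h3
  have h4 := hC {((0 : ℤ), (0 : ℤ)), (1, 0)} {(0, 0), (0, 1)} (by decide)
  rw [show ({((0 : ℤ), (0 : ℤ)), (1, 0)} ∪ {(0, 0), (0, 1)} : Finset (ℤ × ℤ))
      = {(0, 0), (1, 0), (0, 1)} by decide,
    show ({((0 : ℤ), (0 : ℤ)), (1, 0)} ∩ {(0, 0), (0, 1)} : Finset (ℤ × ℤ))
      = {(0, 0)} by decide] at h4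
  linarith
end

section
/- Let S be a map from nonempty finite subsets of ℤ² to ℝ satisfying subadditivity, strong subadditivity, and invariance under every isometry of ℤ². Let T = {(0,0),(1,0),(2,0),(0,1)} be the L-shaped tetromino, let L = {(0,0),(1,0),(0,1)} be the L-shaped tromino, and let I = {(0,0),(1,0),(2,0)} be the straight tromino. Then at least one of the following holds: S(T)/4 ≤ S(L)/3, or S(T)/4 ≤ S(I)/3. -/
/-- For `S` on nonempty finite subsets of `ℤ²` satisfying subadditivity,
strong subadditivity and invariance under every isometry of `ℤ²`: the mean
entropy of the L-shaped tetromino `T` is at most the mean entropy of the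
L-shaped tromino `L`, or at most the mean entropy of the straight
tromino `I` (at least one of the two inequalities holds). -/
theorem meanEntropy_tetromino_le_tromino_or_straight (S : Finset (ℤ × ℤ) → ℝ)
    (hB : ∀ Λ₁ Λ₂ : Finset (ℤ × ℤ), Λ₁.Nonempty → Λ₂.Nonempty →
      Disjoint Λ₁ Λ₂ → S (Λ₁ ∪ Λ₂) ≤ S Λ₁ + S Λ₂)
    (hC : ∀ Λ₁ Λ₂ : Finset (ℤ × ℤ), (Λ₁ ∩ Λ₂).Nonempty →
      S (Λ₁ ∪ Λ₂) + S (Λ₁ ∩ Λ₂) ≤ S Λ₁ + S Λ₂)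
    (hD : ∀ f : ℤ × ℤ → ℤ × ℤ, IsLatticeIsometry f →
      ∀ Λ : Finset (ℤ × ℤ), Λ.Nonempty → S (Λ.image f) = S Λ) :
    S ({((0 : ℤ), (0 : ℤ)), (1, 0), (2, 0), (0, 1)} : Finset (ℤ × ℤ)) / 4 ≤
        S ({((0 : ℤ), (0 : ℤ)), (1, 0), (0, 1)} : Finset (ℤ × ℤ)) / 3 ∨
      S ({((0 : ℤ), (0 : ℤ)), (1, 0), (2, 0), (0, 1)} : Finset (ℤ × ℤ)) / 4 ≤
        S ({((0 : ℤ), (0 : ℤ)), (1, 0), (2, 0)} : Finset (ℤ × ℤ)) / 3 := by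
  have hiso : IsLatticeIsometry (fun p : ℤ × ℤ => (p.1 + 1, p.2)) := by
    refine ⟨⟨?_, ?_⟩, ?_⟩
    · rintro ⟨a, b⟩ ⟨c, d⟩ h
      simpa using h
    · rintro ⟨a, b⟩
      exact ⟨(a - 1, b), by simp⟩
    · intro x y
      ring
  -- a translated point and a translated domino
  have hp : S {((1 : ℤ), (0 : ℤ))} = S {((0 : ℤ), (0 : ℤ))} := by
    have h := hD _ hiso {((0 : ℤ), (0 : ℤ))} (by simp)
    simpa using h
  have hd : S {((1 : ℤ), (0 : ℤ)), (2, 0)} = S {((0 : ℤ), (0 : ℤ)), (1, 0)} := by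
    have h := hD _ hiso {((0 : ℤ), (0 : ℤ)), (1, 0)} (by simp)
    simpa [Finset.image_insert] using h
  -- domino ≤ 2 points
  have h1 := hB {((0 : ℤ), (0 : ℤ))} {(1, 0)} (by simp) (by simp) (by simp)
  rw [show ({((0 : ℤ), (0 : ℤ))} ∪ {(1, 0)} : Finset (ℤ × ℤ)) = {(0, 0), (1, 0)} by decide] at h1
  -- straight tromino + point ≤ 2 dominoes
  have h2 := hC {((0 : ℤ), (0 : ℤ)), (1, 0)} {(1, 0), (2, 0)} (by decide)
  rw [show ({((0 : ℤ), (0 : ℤ)), (1, 0)} ∪ {(1, 0), (2, 0)} : Finset (ℤ × ℤ))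
      = {(0, 0), (1, 0), (2, 0)} by decide,
    show ({((0 : ℤ), (0 : ℤ)), (1, 0)} ∩ {(1, 0), (2, 0)} : Finset (ℤ × ℤ))
      = {(1, 0)} by decide] at h2
  -- tetromino + domino ≤ straight tromino + L-tromino
  have h3 := hC {((0 : ℤ), (0 : ℤ)), (1, 0), (2, 0)} {(0, 0), (1, 0), (0, 1)} (by decide)
  rw [show ({((0 : ℤ), (0 : ℤ)), (1, 0), (2, 0)} ∪ {(0, 0), (1, 0), (0, 1)} : Finset (ℤ × ℤ))
      = {(0, 0), (1, 0), (2, 0), (0, 1)} by decide,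
    show ({((0 : ℤ), (0 : ℤ)), (1, 0), (2, 0)} ∩ {(0, 0), (1, 0), (0, 1)} : Finset (ℤ × ℤ))
      = {(0, 0), (1, 0)} by decide] at h3
  by_contra! hcon
  obtain ⟨hL, hI⟩ := hcon
  linarith
end

section
/- Let S be a map from Lebesgue-measurable subsets of ℝ² of finite nonzero area to ℝ which satisfies subadditivity, strong subadditivity, is unchanged under modification by null sets, and is invariant under every Euclidean isometry of ℝ² (S(f(Λ)) = S(Λ) for every isometry f). Let H be the closed regular hexagon with vertices (cos(kπ/3), sin(kπ/3)), k = 0,…,5, and let H' = 2·H be the concentric regular hexagon with twice the diameter. Then the mean entropy of H' is at most the mean entropy of H: S(H')/area(H') ≤ S(H)/area(H), i.e., S(H')/4 ≤ S(H). -/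
open MeasureTheory Real Pointwise

set_option linter.unusedSimpArgs false
set_option linter.unnecessarySeqFocus false

/-- A continuum region in the plane: a Lebesgue-measurable subset of `ℝ²`
(with the Euclidean metric) of finite nonzero area. -/
def IsPlaneRegion (Λ : Set (EuclideanSpace ℝ (Fin 2))) : Prop :=
  MeasurableSet Λ ∧ volume Λ ≠ 0 ∧ volume Λ ≠ ⊤

/-- The vertices `(cos(kπ/3), sin(kπ/3))`, `k = 0, …, 5`, of a regular
hexagon inscribed in the unit circle. -/
noncomputable def hexVertex (k : Fin 6) : EuclideanSpace ℝ (Fin 2) :=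
  (WithLp.equiv 2 (Fin 2 → ℝ)).symm
    ![Real.cos (k * π / 3), Real.sin (k * π / 3)]

/-- The closed regular hexagon with vertices `(cos(kπ/3), sin(kπ/3))`,
`k = 0, …, 5`. -/
noncomputable def hexagon : Set (EuclideanSpace ℝ (Fin 2)) :=
  convexHull ℝ (Set.range hexVertex)

/-- The plane. -/
abbrev Pl := EuclideanSpace ℝ (Fin 2)

/-- First lattice coordinate. -/
noncomputable def ca : Pl →ₗ[ℝ] ℝ where
  toFun x := x 0 - x 1 / √3
  map_add' x y := by simp; ring
  map_smul' r x := by simp; ring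

/-- Second lattice coordinate. -/
noncomputable def cb : Pl →ₗ[ℝ] ℝ where
  toFun x := 2 * x 1 / √3
  map_add' x y := by simp; ring
  map_smul' r x := by simp; ring

/-- Point with given lattice coordinates. -/
noncomputable def pt (a b : ℝ) : Pl := !₂[a + b / 2, b * √3 / 2]

lemma ca_apply (x : Pl) : ca x = x 0 - x 1 / √3 := rfl
lemma cb_apply (x : Pl) : cb x = 2 * x 1 / √3 := rfl

@[simp] lemma ca_pt (a b : ℝ) : ca (pt a b) = a := by
  have : √3 ≠ 0 := by positivity
  simp [ca_apply, pt]; field_simp; ring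
@[simp] lemma cb_pt (a b : ℝ) : cb (pt a b) = b := by
  have : √3 ≠ 0 := by positivity
  simp [cb_apply, pt]; field_simp

lemma pl_ext {x y : Pl} (h1 : ca x = ca y) (h2 : cb x = cb y) : x = y := by
  have h3 : √3 ≠ 0 := by positivity
  rw [ca_apply, ca_apply] at h1
  rw [cb_apply, cb_apply] at h2
  have h4 : x 1 = y 1 := by field_simp at h2; linarith
  have h5 : x 0 = y 0 := by rw [h4] at h1; linarith
  ext i; fin_cases i
  · exact h5
  · exact h4

lemma null_line (l : Pl →ₗ[ℝ] ℝ) (hl : ∃ x, l x ≠ 0) (c : ℝ) : ∀ᵐ x : Pl, l x ≠ c := by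
  rw [ae_iff]
  simp only [ne_eq, not_not]
  by_cases h : ∃ x0, l x0 = c
  · obtain ⟨x0, h0⟩ := h
    have e : {x | l x = c} = (fun x => x + -x0) ⁻¹' (LinearMap.ker l : Set Pl) := by
      ext x
      simp [h0, ← sub_eq_add_neg, sub_eq_zero]
    rw [e, measure_preimage_add_right]
    apply Measure.addHaar_submodule
    intro ht
    obtain ⟨x, hx⟩ := hl
    exact hx (by rw [LinearMap.ker_eq_top] at ht; simp [ht])
  · push Not at h
    simp [h]

lemma null_lines : ∀ᵐ x : Pl, (ca x ≠ -1 ∧ ca x ≠ 0 ∧ ca x ≠ 1) ∧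
    (cb x ≠ -1 ∧ cb x ≠ 0 ∧ cb x ≠ 1) ∧
    (ca x + cb x ≠ -1 ∧ ca x + cb x ≠ 0 ∧ ca x + cb x ≠ 1) := by
  have ha := null_line ca ⟨pt 1 0, by simp⟩
  have hb := null_line cb ⟨pt 0 1, by simp⟩
  have hc := null_line (ca + cb) ⟨pt 0 1, by simp⟩
  filter_upwards [ha (-1), ha 0, ha 1, hb (-1), hb 0, hb 1, hc (-1), hc 0, hc 1] with
    x h1 h2 h3 h4 h5 h6 h7 h8 h9
  exact ⟨⟨h1, h2, h3⟩, ⟨h4, h5, h6⟩, h7, h8, h9⟩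

/-- The three rhombi. -/
def R1 : Set Pl := {x | 0 ≤ cb x ∧ cb x ≤ 1 ∧ 0 ≤ ca x + cb x ∧ ca x + cb x ≤ 1}
/-- The three rhombi. -/
def R3 : Set Pl := {x | -1 ≤ ca x ∧ ca x ≤ 0 ∧ -1 ≤ ca x + cb x ∧ ca x + cb x ≤ 0}
/-- The three rhombi. -/
def R5 : Set Pl := {x | 0 ≤ ca x ∧ ca x ≤ 1 ∧ -1 ≤ cb x ∧ cb x ≤ 0}

/-- The hexagon, by inequalities. -/
def Hx : Set Pl := {x | -1 ≤ ca x ∧ ca x ≤ 1 ∧ -1 ≤ cb x ∧ cb x ≤ 1 ∧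
  -1 ≤ ca x + cb x ∧ ca x + cb x ≤ 1}

lemma hexVertex_0 : hexVertex 0 = pt 1 0 := by
  ext i; fin_cases i <;> simp [hexVertex, pt]
lemma hexVertex_1 : hexVertex 1 = pt 0 1 := by
  ext i; fin_cases i <;> simp [hexVertex, pt]
lemma hexVertex_2 : hexVertex 2 = pt (-1) 1 := by
  have e : 2 * π / 3 = π - π / 3 := by ring
  ext i; fin_cases i <;> simp [hexVertex, pt, e] <;> norm_num
lemma hexVertex_3 : hexVertex 3 = pt (-1) 0 := by
  have e : 3 * π / 3 = π := by ring
  ext i; fin_cases i <;> simp [hexVertex, pt, e]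
lemma hexVertex_4 : hexVertex 4 = pt 0 (-1) := by
  have e : 4 * π / 3 = π / 3 + π := by ring
  ext i; fin_cases i <;> simp [hexVertex, pt, e, cos_add_pi, sin_add_pi] <;> ring
lemma hexVertex_5 : hexVertex 5 = pt 1 (-1) := by
  have e : 5 * π / 3 = -(π / 3) + 2 * π := by ring
  ext i; fin_cases i <;> simp [hexVertex, pt, e, cos_add_two_pi, sin_add_two_pi] <;> ring

lemma cont_ca : Continuous ca := LinearMap.continuous_of_finiteDimensional _
lemma cont_cb : Continuous cb := LinearMap.continuous_of_finiteDimensional _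

lemma Hx_convex : Convex ℝ Hx := by
  intro x hx y hy s t hs ht hst
  obtain ⟨h1, h2, h3, h4, h5, h6⟩ := hx
  obtain ⟨k1, k2, k3, k4, k5, k6⟩ := hy
  have e : t = 1 - s := by linarith
  subst e
  simp only [Hx, Set.mem_ofPred_eq, map_add, map_smul, smul_eq_mul]
  refine ⟨?_, ?_, ?_, ?_, ?_, ?_⟩ <;> nlinarith

lemma hexagon_eq : hexagon = Hx := by
  have hv : ∀ k, hexVertex k ∈ hexagon := fun k => subset_convexHull ℝ _ ⟨k, rfl⟩
  have hcv : Convex ℝ hexagon := convex_convexHull ℝ _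
  have v0 := hexVertex_0 ▸ hv 0
  have v1 := hexVertex_1 ▸ hv 1
  have v2 := hexVertex_2 ▸ hv 2
  have v3 := hexVertex_3 ▸ hv 3
  have v4 := hexVertex_4 ▸ hv 4
  have v5 := hexVertex_5 ▸ hv 5
  have z : pt 0 0 ∈ hexagon := by
    have := hcv v0 v3 (a := 1/2) (b := 1/2) (by norm_num) (by norm_num) (by norm_num)
    convert this using 1
    apply pl_ext <;> simp
  have tri : ∀ {p q : Pl}, p ∈ hexagon → q ∈ hexagon → ∀ s t : ℝ, 0 ≤ s → 0 ≤ t → s + t ≤ 1 →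
      s • p + t • q ∈ hexagon := by
    intro p q hp hq s t hs ht hst
    have z' : (0 : Pl) ∈ hexagon := by
      convert z using 1
      apply pl_ext <;> simp
    have := hcv.sum_mem (t := Finset.univ) (w := ![s, t, 1 - s - t]) (z := ![p, q, 0])
      (by intro i _; fin_cases i <;> simp <;> linarith)
      (by simp [Fin.sum_univ_succ])
      (by intro i _; fin_cases i <;> simp [hp, hq, z'])
    simpa [Fin.sum_univ_succ] using this
  apply Set.Subset.antisymm
  · apply convexHull_min _ Hx_convex
    rintro _ ⟨k, rfl⟩
    fin_cases k
    · change hexVertex 0 ∈ _; rw [hexVertex_0]; simp [Hx]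
    · change hexVertex 1 ∈ _; rw [hexVertex_1]; simp [Hx]
    · change hexVertex 2 ∈ _; rw [hexVertex_2]; simp [Hx]
    · change hexVertex 3 ∈ _; rw [hexVertex_3]; simp [Hx]
    · change hexVertex 4 ∈ _; rw [hexVertex_4]; simp [Hx]
    · change hexVertex 5 ∈ _; rw [hexVertex_5]; simp [Hx]
  · rintro x ⟨h1, h2, h3, h4, h5, h6⟩
    have key : ∀ {p q : Pl}, p ∈ hexagon → q ∈ hexagon → ∀ s t : ℝ, 0 ≤ s → 0 ≤ t → s + t ≤ 1 →
      ca x = s * ca p + t * ca q → cb x = s * cb p + t * cb q → x ∈ hexagon := by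
      intro p q hp hq s t hs ht hst e1 e2
      have := tri hp hq s t hs ht hst
      convert this using 1
      apply pl_ext <;> simp [e1, e2]
    rcases le_total 0 (ca x) with ha | ha <;> rcases le_total 0 (cb x) with hb | hb
    · apply key v0 v1 (ca x) (cb x) <;> (try simp only [ca_pt, cb_pt]) <;> linarith
    · rcases le_total 0 (ca x + cb x) with hc | hc
      · apply key v0 v5 (ca x + cb x) (-cb x) <;> (try simp only [ca_pt, cb_pt]) <;> linarith
      · apply key v4 v5 (-(ca x + cb x)) (ca x) <;> (try simp only [ca_pt, cb_pt]) <;> linarith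
    · rcases le_total 0 (ca x + cb x) with hc | hc
      · apply key v1 v2 (ca x + cb x) (-ca x) <;> (try simp only [ca_pt, cb_pt]) <;> linarith
      · apply key v3 v2 (-(ca x + cb x)) (cb x) <;> (try simp only [ca_pt, cb_pt]) <;> linarith
    · apply key v3 v4 (-ca x) (-cb x) <;> (try simp only [ca_pt, cb_pt]) <;> linarith

/-- Rotation by 120 degrees. -/
noncomputable def rot (x : Pl) : Pl := pt (-ca x - cb x) (ca x)

@[simp] lemma ca_rot (x : Pl) : ca (rot x) = -ca x - cb x := by simp [rot]
@[simp] lemma cb_rot (x : Pl) : cb (rot x) = ca x := by simp [rot]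

lemma rot3 (x : Pl) : rot (rot (rot x)) = x := by
  apply pl_ext
  · simp
    ring
  · simp

lemma rot_surj : Function.Surjective rot := fun x => ⟨rot (rot x), rot3 x⟩

lemma dist_coord (x y : Pl) : dist x y = √((ca x - ca y) ^ 2 + (ca x - ca y) * (cb x - cb y) +
    (cb x - cb y) ^ 2) := by
  rw [EuclideanSpace.dist_eq, Fin.sum_univ_two, Real.dist_eq, Real.dist_eq, sq_abs, sq_abs]
  congr 1
  rw [ca_apply, ca_apply, cb_apply, cb_apply]
  have h : √3 ≠ 0 := by positivity
  have h2 : √3 ^ 2 = 3 := by norm_num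
  field_simp
  ring_nf
  rw [h2]; ring

lemma rot_isom : Isometry rot := by
  apply Isometry.of_dist_eq
  intro x y
  rw [dist_coord, dist_coord]
  congr 1
  simp
  ring

lemma mem_rot (A : Set Pl) (x : Pl) : x ∈ rot '' A ↔ rot (rot x) ∈ A := by
  constructor
  · rintro ⟨y, hy, rfl⟩; rwa [rot3]
  · intro h; exact ⟨_, h, rot3 x⟩

/-- Translation. -/
noncomputable def tr (a b : ℝ) (A : Set Pl) : Set Pl := (fun x => x + pt a b) '' A

lemma mem_tr (a b : ℝ) (A : Set Pl) (x : Pl) : x ∈ tr a b A ↔ x - pt a b ∈ A := by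
  simp [tr, sub_eq_add_neg]

lemma isom_region (f : Pl → Pl) (hf : Isometry f) (hs : Function.Surjective f) {A : Set Pl}
    (hA : IsPlaneRegion A) : IsPlaneRegion (f '' A) := by
  let e : Pl ≃ᵢ Pl := ⟨Equiv.ofBijective f ⟨hf.injective, hs⟩, hf⟩
  have hv : volume (f '' A) = volume A := by
    have := hf.euclideanHausdorffMeasure_image (d := 2) A
    rwa [EuclideanSpace.euclideanHausdorffMeasure_eq_volume] at this
  refine ⟨?_, by rw [hv]; exact hA.2.1, by rw [hv]; exact hA.2.2⟩
  exact (e.toHomeomorph.toMeasurableEquiv.measurableSet_image).2 hA.1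

lemma union_region {A B : Set Pl} (hA : IsPlaneRegion A) (hB : IsPlaneRegion B) :
    IsPlaneRegion (A ∪ B) :=
  ⟨hA.1.union hB.1, fun h => hA.2.1 (measure_mono_null Set.subset_union_left h),
    (measure_union_lt_top hA.2.2.lt_top hB.2.2.lt_top).ne⟩

lemma R1_region : IsPlaneRegion R1 := by
  have ha := cont_ca
  have hb := cont_cb
  refine ⟨?_, ?_, ?_⟩
  · apply IsClosed.measurableSet
    unfold R1
    exact (isClosed_le continuous_const hb).inter <|
      (isClosed_le hb continuous_const).inter <|
      (isClosed_le continuous_const (ha.add hb)).inter (isClosed_le (ha.add hb) continuous_const)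
  · have ho : IsOpen {x : Pl | 0 < cb x ∧ cb x < 1 ∧ 0 < ca x + cb x ∧ ca x + cb x < 1} :=
      (isOpen_lt continuous_const hb).inter <|
      (isOpen_lt hb continuous_const).inter <|
      (isOpen_lt continuous_const (ha.add hb)).inter (isOpen_lt (ha.add hb) continuous_const)
    have := ho.measure_pos volume ⟨pt 0 (1/2), by simp; norm_num⟩
    refine (this.trans_le (measure_mono ?_)).ne'
    rintro x ⟨h1, h2, h3, h4⟩
    exact ⟨h1.le, h2.le, h3.le, h4.le⟩
  · have hs : R1 ⊆ hexagon := by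
      rw [hexagon_eq]
      rintro x ⟨h1, h2, h3, h4⟩
      refine ⟨?_, ?_, ?_, ?_, ?_, ?_⟩ <;> linarith
    have hc : IsCompact hexagon := (Set.finite_range hexVertex).isCompact_convexHull (𝕜 := ℝ)
    exact ((measure_mono hs).trans_lt hc.measure_lt_top).ne

lemma R3_eq : R3 = rot '' R1 := by
  ext x; rw [mem_rot]; simp only [R1, R3, Set.mem_ofPred_eq, ca_rot, cb_rot]
  constructor <;> rintro ⟨h1, h2, h3, h4⟩ <;> refine ⟨?_, ?_, ?_, ?_⟩ <;> linarith
lemma R5_eq : R5 = rot '' R3 := by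
  ext x; rw [mem_rot]; simp only [R5, R3, Set.mem_ofPred_eq, ca_rot, cb_rot]
  constructor <;> rintro ⟨h1, h2, h3, h4⟩ <;> refine ⟨?_, ?_, ?_, ?_⟩ <;> linarith
lemma R1_eq : R1 = rot '' R5 := by
  ext x; rw [mem_rot]; simp only [R5, R1, Set.mem_ofPred_eq, ca_rot, cb_rot]
  constructor <;> rintro ⟨h1, h2, h3, h4⟩ <;> refine ⟨?_, ?_, ?_, ?_⟩ <;> linarith

lemma R3_region : IsPlaneRegion R3 := R3_eq ▸ isom_region _ rot_isom rot_surj R1_region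
lemma R5_region : IsPlaneRegion R5 := R5_eq ▸ isom_region _ rot_isom rot_surj R3_region

lemma Hx_eq : Hx = (R1 ∪ R3) ∪ R5 := by
  ext x
  simp only [Hx, R1, R3, R5, Set.mem_union, Set.mem_ofPred_eq]
  grind

lemma Hx_region : IsPlaneRegion Hx := Hx_eq ▸ union_region (union_region R1_region R3_region) R5_region

lemma tr_isom (a b : ℝ) : Isometry (fun x : Pl => x + pt a b) := isometry_add_right _
lemma tr_surj (a b : ℝ) : Function.Surjective (fun x : Pl => x + pt a b) :=
  fun x => ⟨x - pt a b, by simp⟩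
lemma tr_region (a b : ℝ) {A : Set Pl} (hA : IsPlaneRegion A) : IsPlaneRegion (tr a b A) :=
  isom_region _ (tr_isom a b) (tr_surj a b) hA

lemma null_of {A B : Set Pl} (h : ∀ x, (ca x ≠ -1 ∧ ca x ≠ 0 ∧ ca x ≠ 1) ∧
    (cb x ≠ -1 ∧ cb x ≠ 0 ∧ cb x ≠ 1) ∧
    (ca x + cb x ≠ -1 ∧ ca x + cb x ≠ 0 ∧ ca x + cb x ≠ 1) → x ∈ A → x ∈ B → False) :
    volume (A ∩ B) = 0 := by
  rw [measure_eq_zero_iff_ae_notMem]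
  filter_upwards [null_lines] with x hx hm
  exact h x hx hm.1 hm.2

lemma symm_null_of {A B : Set Pl} (h : ∀ x, (ca x ≠ -1 ∧ ca x ≠ 0 ∧ ca x ≠ 1) ∧
    (cb x ≠ -1 ∧ cb x ≠ 0 ∧ cb x ≠ 1) ∧
    (ca x + cb x ≠ -1 ∧ ca x + cb x ≠ 0 ∧ ca x + cb x ≠ 1) → (x ∈ A ↔ x ∈ B)) :
    volume (symmDiff A B) = 0 := by
  rw [measure_symmDiff_eq_zero_iff]
  filter_upwards [null_lines] with x hx
  exact propext (h x hx)

lemma region_congr {A B : Set Pl} (hA : IsPlaneRegion A) (hm : MeasurableSet B)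
    (h : volume (symmDiff A B) = 0) : IsPlaneRegion B := by
  rw [measure_symmDiff_eq_zero_iff] at h
  have := measure_congr h
  exact ⟨hm, this ▸ hA.2.1, this ▸ hA.2.2⟩

lemma n1 : volume (symmDiff R5 ((R3 ∪ R5) ∩ (R5 ∪ R1))) = 0 := by
  apply symm_null_of
  intro x
  simp only [mem_tr, Hx, R1, R3, R5, Set.mem_union, Set.mem_inter_iff, Set.mem_ofPred_eq, map_sub, ca_pt, cb_pt]
  generalize ca x = a
  generalize cb x = b
  rintro ⟨⟨a1, a2, a3⟩, ⟨b1, b2, b3⟩, c1, c2, c3⟩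
  grind

lemma n2 : volume ((R1 ∪ R3) ∩ R5) = 0 := by
  apply null_of
  intro x
  simp only [mem_tr, Hx, R1, R3, R5, Set.mem_union, Set.mem_inter_iff, Set.mem_ofPred_eq, map_sub, ca_pt, cb_pt]
  generalize ca x = a
  generalize cb x = b
  rintro ⟨⟨a1, a2, a3⟩, ⟨b1, b2, b3⟩, c1, c2, c3⟩
  grind

lemma n3 : volume (tr 1 0 Hx ∩ tr (-1) 1 Hx) = 0 := by
  apply null_of
  intro x
  simp only [mem_tr, Hx, R1, R3, R5, Set.mem_union, Set.mem_inter_iff, Set.mem_ofPred_eq, map_sub, ca_pt, cb_pt]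
  generalize ca x = a
  generalize cb x = b
  rintro ⟨⟨a1, a2, a3⟩, ⟨b1, b2, b3⟩, c1, c2, c3⟩
  grind

lemma n4 : volume ((tr 1 0 Hx ∪ tr (-1) 1 Hx) ∩ tr 0 (-1) Hx) = 0 := by
  apply null_of
  intro x
  simp only [mem_tr, Hx, R1, R3, R5, Set.mem_union, Set.mem_inter_iff, Set.mem_ofPred_eq, map_sub, ca_pt, cb_pt]
  generalize ca x = a
  generalize cb x = b
  rintro ⟨⟨a1, a2, a3⟩, ⟨b1, b2, b3⟩, c1, c2, c3⟩
  grind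

lemma n5 : volume (symmDiff (tr 0 1 (R3 ∪ R5)) ((tr 1 0 Hx ∪ tr (-1) 1 Hx ∪ tr 0 (-1) Hx) ∩ tr 0 1 Hx)) = 0 := by
  apply symm_null_of
  intro x
  simp only [mem_tr, Hx, R1, R3, R5, Set.mem_union, Set.mem_inter_iff, Set.mem_ofPred_eq, map_sub, ca_pt, cb_pt]
  generalize ca x = a
  generalize cb x = b
  rintro ⟨⟨a1, a2, a3⟩, ⟨b1, b2, b3⟩, c1, c2, c3⟩
  grind

lemma n6 : volume (symmDiff (tr (-1) 0 (R5 ∪ R1)) ((tr 1 0 Hx ∪ tr (-1) 1 Hx ∪ tr 0 (-1) Hx ∪ tr 0 1 Hx) ∩ tr (-1) 0 Hx)) = 0 := by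
  apply symm_null_of
  intro x
  simp only [mem_tr, Hx, R1, R3, R5, Set.mem_union, Set.mem_inter_iff, Set.mem_ofPred_eq, map_sub, ca_pt, cb_pt]
  generalize ca x = a
  generalize cb x = b
  rintro ⟨⟨a1, a2, a3⟩, ⟨b1, b2, b3⟩, c1, c2, c3⟩
  constructor
  · rintro (⟨h1, h2, h3, h4⟩ | ⟨h1, h2, h3, h4⟩)
    · exact ⟨Or.inl (Or.inr (by refine ⟨?_, ?_, ?_, ?_, ?_, ?_⟩ <;> linarith)), by refine ⟨?_, ?_, ?_, ?_, ?_, ?_⟩ <;> linarith⟩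
    · exact ⟨Or.inl (Or.inl (Or.inr (by refine ⟨?_, ?_, ?_, ?_, ?_, ?_⟩ <;> linarith))), by refine ⟨?_, ?_, ?_, ?_, ?_, ?_⟩ <;> linarith⟩
  · rintro ⟨((h | h) | h) | h, k1, k2, k3, k4, k5, k6⟩ <;> obtain ⟨h1, h2, h3, h4, h5, h6⟩ := h <;> grind

lemma n7 : volume (symmDiff (tr 1 (-1) (R1 ∪ R3)) ((tr 1 0 Hx ∪ tr (-1) 1 Hx ∪ tr 0 (-1) Hx ∪ tr 0 1 Hx ∪ tr (-1) 0 Hx) ∩ tr 1 (-1) Hx)) = 0 := by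
  apply symm_null_of
  intro x
  simp only [mem_tr, Hx, R1, R3, R5, Set.mem_union, Set.mem_inter_iff, Set.mem_ofPred_eq, map_sub, ca_pt, cb_pt]
  generalize ca x = a
  generalize cb x = b
  rintro ⟨⟨a1, a2, a3⟩, ⟨b1, b2, b3⟩, c1, c2, c3⟩
  constructor
  · rintro (⟨h1, h2, h3, h4⟩ | ⟨h1, h2, h3, h4⟩)
    · exact ⟨Or.inl (Or.inl (Or.inl (Or.inl (by refine ⟨?_, ?_, ?_, ?_, ?_, ?_⟩ <;> linarith)))), by refine ⟨?_, ?_, ?_, ?_, ?_, ?_⟩ <;> linarith⟩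
    · exact ⟨Or.inl (Or.inl (Or.inr (by refine ⟨?_, ?_, ?_, ?_, ?_, ?_⟩ <;> linarith))), by refine ⟨?_, ?_, ?_, ?_, ?_, ?_⟩ <;> linarith⟩
  · rintro ⟨(((h | h) | h) | h) | h, k1, k2, k3, k4, k5, k6⟩ <;> obtain ⟨h1, h2, h3, h4, h5, h6⟩ := h <;> grind

lemma two_hex : (2 : ℝ) • hexagon = tr 1 0 Hx ∪ tr (-1) 1 Hx ∪ tr 0 (-1) Hx ∪ tr 0 1 Hx ∪ tr (-1) 0 Hx ∪ tr 1 (-1) Hx := by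
  ext x
  rw [Set.mem_smul_set_iff_inv_smul_mem₀ (by norm_num), hexagon_eq]
  simp only [mem_tr, Hx, Set.mem_union, Set.mem_ofPred_eq, map_sub, ca_pt, cb_pt, map_smul,
    smul_eq_mul]
  generalize ca x = a
  generalize cb x = b
  constructor
  · rintro ⟨h1, h2, h3, h4, h5, h6⟩
    rcases le_total 0 a with ha | ha <;> rcases le_total 0 b with hb | hb
    · rcases le_total b 1 with hd | hd
      · exact Or.inl (Or.inl (Or.inl (Or.inl (Or.inl (by refine ⟨?_, ?_, ?_, ?_, ?_, ?_⟩ <;> linarith)))))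
      · exact Or.inl (Or.inl (Or.inr (by refine ⟨?_, ?_, ?_, ?_, ?_, ?_⟩ <;> linarith)))
    · rcases le_total 0 (a + b) with hc | hc
      · rcases le_total (a + b) 1 with hd | hd
        · exact Or.inr (by refine ⟨?_, ?_, ?_, ?_, ?_, ?_⟩ <;> linarith)
        · exact Or.inl (Or.inl (Or.inl (Or.inl (Or.inl (by refine ⟨?_, ?_, ?_, ?_, ?_, ?_⟩ <;> linarith)))))
      · rcases le_total (-1) (a + b) with hd | hd
        · exact Or.inr (by refine ⟨?_, ?_, ?_, ?_, ?_, ?_⟩ <;> linarith)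
        · exact Or.inl (Or.inl (Or.inl (Or.inr (by refine ⟨?_, ?_, ?_, ?_, ?_, ?_⟩ <;> linarith))))
    · rcases le_total 0 (a + b) with hc | hc
      · rcases le_total (a + b) 1 with hd | hd
        · exact Or.inl (Or.inl (Or.inl (Or.inl (Or.inr (by refine ⟨?_, ?_, ?_, ?_, ?_, ?_⟩ <;> linarith)))))
        · exact Or.inl (Or.inl (Or.inr (by refine ⟨?_, ?_, ?_, ?_, ?_, ?_⟩ <;> linarith)))
      · rcases le_total (-1) (a + b) with hd | hd
        · exact Or.inl (Or.inl (Or.inl (Or.inl (Or.inr (by refine ⟨?_, ?_, ?_, ?_, ?_, ?_⟩ <;> linarith)))))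
        · exact Or.inl (Or.inr (by refine ⟨?_, ?_, ?_, ?_, ?_, ?_⟩ <;> linarith))
    · rcases le_total (-1) b with hd | hd
      · exact Or.inl (Or.inr (by refine ⟨?_, ?_, ?_, ?_, ?_, ?_⟩ <;> linarith))
      · exact Or.inl (Or.inl (Or.inl (Or.inr (by refine ⟨?_, ?_, ?_, ?_, ?_, ?_⟩ <;> linarith))))
  · rintro (((((h | h) | h) | h) | h) | h) <;> obtain ⟨h1, h2, h3, h4, h5, h6⟩ := h <;>
      refine ⟨?_, ?_, ?_, ?_, ?_, ?_⟩ <;> linarith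

/-- For an entropy function `S` on regions of `ℝ²` which is unchanged under
modification by null sets and satisfies subadditivity, strong subadditivity
and invariance under every Euclidean isometry of `ℝ²`: the mean entropy of
the regular hexagon `H' = 2·H` of twice the diameter is at most the mean
entropy of the regular hexagon `H`. -/
theorem meanEntropy_doubled_hexagon_le (S : Set (EuclideanSpace ℝ (Fin 2)) → ℝ)
    (hNull : ∀ Λ Λ' : Set (EuclideanSpace ℝ (Fin 2)), IsPlaneRegion Λ →
      IsPlaneRegion Λ' → volume (symmDiff Λ Λ') = 0 → S Λ = S Λ')
    (hB : ∀ Λ₁ Λ₂ : Set (EuclideanSpace ℝ (Fin 2)), IsPlaneRegion Λ₁ →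
      IsPlaneRegion Λ₂ → volume (Λ₁ ∩ Λ₂) = 0 → S (Λ₁ ∪ Λ₂) ≤ S Λ₁ + S Λ₂)
    (hC : ∀ Λ₁ Λ₂ : Set (EuclideanSpace ℝ (Fin 2)), IsPlaneRegion Λ₁ →
      IsPlaneRegion Λ₂ → volume (Λ₁ ∩ Λ₂) ≠ 0 →
      S (Λ₁ ∪ Λ₂) + S (Λ₁ ∩ Λ₂) ≤ S Λ₁ + S Λ₂)
    (hD : ∀ f : EuclideanSpace ℝ (Fin 2) → EuclideanSpace ℝ (Fin 2),
      Isometry f → Function.Surjective f →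
      ∀ Λ : Set (EuclideanSpace ℝ (Fin 2)), IsPlaneRegion Λ →
        S (f '' Λ) = S Λ) :
    S ((2 : ℝ) • hexagon) / (volume ((2 : ℝ) • hexagon)).toReal ≤
      S hexagon / (volume hexagon).toReal := by
  have T : ∀ (a b : ℝ) {A : Set Pl}, IsPlaneRegion A → S (tr a b A) = S A := fun a b A hA =>
    hD _ (tr_isom a b) (tr_surj a b) A hA
  have Rt : ∀ {A : Set Pl}, IsPlaneRegion A → S (rot '' A) = S A := fun {A} hA =>
    hD _ rot_isom rot_surj A hA
  have hC' : ∀ {A B I : Set Pl}, IsPlaneRegion A → IsPlaneRegion B → IsPlaneRegion I →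
      volume (symmDiff I (A ∩ B)) = 0 → S (A ∪ B) + S I ≤ S A + S B := by
    intro A B I hA hB' hI h
    have hr := region_congr hI (hA.1.inter hB'.1) h
    rw [hNull I _ hI hr h]
    exact hC A B hA hB' hr.2.1
  have q1 := union_region R3_region R5_region
  have q3 := union_region R5_region R1_region
  have q5 := union_region R1_region R3_region
  have e3 : S (R5 ∪ R1) = S (R3 ∪ R5) := by
    rw [← Rt q1, Set.image_union, ← R1_eq, ← R5_eq]
  have e5 : S (R1 ∪ R3) = S (R3 ∪ R5) := by
    rw [← e3, ← Rt q3, Set.image_union, ← R1_eq, ← R3_eq]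
  have i1 : S Hx + S R5 ≤ S (R3 ∪ R5) + S (R5 ∪ R1) := by
    have := hC' q1 q3 R5_region n1
    convert this using 3
    rw [Hx_eq]; ext; simp only [Set.mem_union]; tauto
  have i2 : S Hx ≤ S (R1 ∪ R3) + S R5 := by
    rw [Hx_eq]
    exact hB _ _ q5 R5_region n2
  have h0 := tr_region 1 0 Hx_region
  have h2 := tr_region (-1) 1 Hx_region
  have h4 := tr_region 0 (-1) Hx_region
  have h1 := tr_region 0 1 Hx_region
  have h3 := tr_region (-1) 0 Hx_region
  have h5 := tr_region 1 (-1) Hx_region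
  have u02 := union_region h0 h2
  have u := union_region u02 h4
  have u1 := union_region u h1
  have u3 := union_region u1 h3
  have j2 := hB _ _ h0 h2 n3
  have j4 := hB _ _ u02 h4 n4
  have k1 := hC' u h1 (tr_region 0 1 q1) n5
  have k3 := hC' u1 h3 (tr_region (-1) 0 q3) n6
  have k5 := hC' u3 h5 (tr_region 1 (-1) q5) n7
  rw [← two_hex] at k5
  rw [T _ _ Hx_region, T _ _ Hx_region] at j2
  rw [T _ _ Hx_region] at j4
  rw [T _ _ Hx_region, T _ _ q1] at k1
  rw [T _ _ Hx_region, T _ _ q3] at k3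
  rw [T _ _ Hx_region, T _ _ q5] at k5
  have main : S ((2 : ℝ) • hexagon) ≤ 4 * S hexagon := by
    rw [hexagon_eq] at *
    linarith
  have hv : (volume ((2 : ℝ) • hexagon)).toReal = 4 * (volume hexagon).toReal := by
    rw [Measure.addHaar_smul]
    simp
    norm_num
  have hpos : 0 < (volume hexagon).toReal := by
    rw [hexagon_eq]
    exact ENNReal.toReal_pos Hx_region.2.1 Hx_region.2.2
  rw [hv, div_le_div_iff₀ (by positivity) hpos]
  nlinarith
end

section
/- Let S : ℝ → ℝ be defined on (0, 2π], representing the entropy of an arc of angular length θ on the continuum unit circle for a rotation-invariant entropy assignment, and suppose: S(θ) ≥ 0 for all θ ∈ (0, 2π]; S(q + r) ≤ S(q) + S(r) for all q, r > 0 with q + r ≤ 2π; and S(q + r + t) + S(r) ≤ S(q + r) + S(r + t) for all q, r, t > 0 with q + r + t ≤ 2π. Then the mean entropy of arcs is monotonically decreasing: S(θ₁)/θ₁ ≥ S(θ₂)/θ₂ for all 0 < θ₁ ≤ θ₂ ≤ 2π. -/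
open Real

/-- Monotonicity of mean entropy of arcs on the continuum unit circle: for a
rotation-invariant entropy assignment, with `S θ` the entropy of an arc of
angular length `θ ∈ (0, 2π]` satisfying positivity, subadditivity and strong
subadditivity for arcs, the mean entropy `S(θ)/θ` is monotonically
decreasing. -/
theorem meanEntropy_antitone_circle (S : ℝ → ℝ)
    (hA : ∀ θ : ℝ, 0 < θ → θ ≤ 2 * π → 0 ≤ S θ)
    (hB : ∀ q r : ℝ, 0 < q → 0 < r → q + r ≤ 2 * π →
      S (q + r) ≤ S q + S r)
    (hC : ∀ q r t : ℝ, 0 < q → 0 < r → 0 < t → q + r + t ≤ 2 * π →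
      S (q + r + t) + S r ≤ S (q + r) + S (r + t)) :
    ∀ θ₁ θ₂ : ℝ, 0 < θ₁ → θ₁ ≤ θ₂ → θ₂ ≤ 2 * π → S θ₂ / θ₂ ≤ S θ₁ / θ₁ := by
  intro x y hx hxy hy
  rcases hxy.eq_or_lt with rfl | hlt
  · exact le_rfl
  have hy0 : 0 < y := hx.trans hlt
  have hSx := hA x hx (hxy.trans hy)
  have hSy := hA y hy0 hy
  rw [div_le_div_iff₀ hy0 hx]
  by_contra hcon
  push Not at hcon
  obtain ⟨n, hn⟩ := exists_nat_gt ((y - x) * S y / (S y * x - S x * y))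
  rw [div_lt_iff₀ (by linarith)] at hn
  obtain ⟨N, rfl⟩ : ∃ N, n = N + 1 := by
    rcases n with _ | N
    · have := mul_nonneg (sub_nonneg.2 hxy) hSy
      simp at hn
      linarith
    · exact ⟨N, rfl⟩
  have hNpos : (0 : ℝ) < ((N + 1 : ℕ) : ℝ) := by positivity
  obtain ⟨h, hh⟩ : ∃ h : ℝ, h = (y - x) / ((N + 1 : ℕ) : ℝ) := ⟨_, rfl⟩
  have hpos : 0 < h := by rw [hh]; exact div_pos (by linarith) hNpos
  have hNh : ((N + 1 : ℕ) : ℝ) * h = y - x := by rw [hh]; field_simp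
  -- forward steps
  have fwd : ∀ m : ℕ, x + ((m : ℝ) + 1) * h ≤ 2 * π →
      S (x + ((m : ℝ) + 1) * h) ≤ S x + ((m : ℝ) + 1) * (S (x + h) - S x) := by
    intro m
    induction m with
    | zero => intro _; simp
    | succ m ih =>
      intro hm
      push_cast at hm ⊢
      have h1 := ih (by nlinarith)
      have h2 := hC (((m : ℝ) + 1) * h) x h (by positivity) hx hpos (by linarith)
      rw [show ((m : ℝ) + 1) * h + x + h = x + ((m : ℝ) + 1 + 1) * h by ring,
        show ((m : ℝ) + 1) * h + x = x + ((m : ℝ) + 1) * h by ring] at h2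
      linarith
  have hN := fwd N (by push_cast at hNh; linarith)
  have hxhy : x + h ≤ 2 * π := by
    push_cast at hNh
    have : 0 ≤ (N : ℝ) * h := by positivity
    linarith
  -- backward steps
  have bwd : ∀ k : ℕ, 0 < x - (k : ℝ) * h →
      S (x - (k : ℝ) * h) ≤ S x - (k : ℝ) * (S (x + h) - S x) := by
    intro k
    induction k with
    | zero => intro _; simp
    | succ k ih =>
      intro hk
      push_cast at hk ⊢
      have h1 := ih (by linarith)
      have h2 := hC (((k : ℝ) + 1) * h) (x - ((k : ℝ) + 1) * h) h (by positivity) hk hpos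
        (by linarith)
      rw [show ((k : ℝ) + 1) * h + (x - ((k : ℝ) + 1) * h) + h = x + h by ring,
        show ((k : ℝ) + 1) * h + (x - ((k : ℝ) + 1) * h) = x by ring,
        show x - ((k : ℝ) + 1) * h + h = x - (k : ℝ) * h by ring] at h2
      linarith
  obtain ⟨K, hK1, hK2⟩ : ∃ K : ℕ, (K : ℝ) * h < x ∧ x ≤ ((K : ℝ) + 1) * h := by
    have hc : 0 < ⌈x / h⌉₊ := Nat.ceil_pos.2 (div_pos hx hpos)
    obtain ⟨K, hK⟩ := Nat.exists_eq_succ_of_ne_zero hc.ne'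
    refine ⟨K, ?_, ?_⟩
    · rw [← lt_div_iff₀ hpos]
      exact Nat.lt_ceil.1 (by omega)
    · rw [← div_le_iff₀ hpos]
      have := Nat.le_ceil (x / h)
      rw [hK] at this
      simpa using this
  have hKd : (K : ℝ) * (S (x + h) - S x) ≤ S x := by
    have h1 := bwd K (by linarith)
    have : 0 ≤ (K : ℝ) * h := by positivity
    have h2 := hA (x - (K : ℝ) * h) (by linarith) (by linarith)
    linarith
  push_cast at hNh hn hNpos
  rw [hNh, add_sub_cancel] at hN
  generalize S (x + h) - S x = d at *
  have hK0 : (0 : ℝ) ≤ K := Nat.cast_nonneg K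
  have e1 : (K : ℝ) * S y ≤ ((K : ℝ) + (N + 1)) * S x := by
    have a1 := mul_le_mul_of_nonneg_left hN hK0
    have a2 := mul_le_mul_of_nonneg_left hKd hNpos.le
    linarith
  have e2 : (K : ℝ) * h * S y ≤ ((K : ℝ) * h + (y - x)) * S x := by
    have := mul_le_mul_of_nonneg_left e1 hpos.le
    rw [← hNh]
    linarith
  have e3 : ((K : ℝ) * h + (y - x)) * S x ≤ y * S x :=
    mul_le_mul_of_nonneg_right (by linarith) hSx
  have e4 : (x - h) * S y ≤ (K : ℝ) * h * S y :=
    mul_le_mul_of_nonneg_right (by linarith) hSy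
  have e5 : S y * x - S x * y ≤ h * S y := by linarith
  have e6 := mul_le_mul_of_nonneg_left e5 hNpos.le
  rw [← hNh] at hn
  linarith
end
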